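/- arXiv:1604.08603 — 10 statements merged into one kernel-verified Lean document; each statement's English description precedes it below -/
import Mathlib

section
/- Let G be a connected cubic graph that admits a {K_3, P_4}-decomposition D. Then no part of D is a K_3, i.e., every part of D is a path P_4. -/
open SimpleGraph

variable {V : Type*}

def IsTriangleOn (G : SimpleGraph V) (u v w : V) : Prop :=
  G.Adj u v ∧ G.Adj v w ∧ G.Adj u w

def triEdges [DecidableEq V] (u v w : V) : Finset (Sym2 V) :=
  {s(u, v), s(v, w), s(u, w)}

def IsTrianglePart [DecidableEq V] (G : SimpleGraph V) (P : Finset (Sym2 V)) : Prop :=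
  ∃ u v w : V, IsTriangleOn G u v w ∧ P = triEdges u v w

def clawEdges [DecidableEq V] (c a b d : V) : Finset (Sym2 V) :=
  {s(c, a), s(c, b), s(c, d)}

def IsClawPart [DecidableEq V] (G : SimpleGraph V) (P : Finset (Sym2 V)) : Prop :=
  ∃ c a b d : V, a ≠ b ∧ a ≠ d ∧ b ≠ d ∧
    G.Adj c a ∧ G.Adj c b ∧ G.Adj c d ∧ P = clawEdges c a b d

def p4Edges [DecidableEq V] (a b c d : V) : Finset (Sym2 V) :=
  {s(a, b), s(b, c), s(c, d)}

def IsP4On (G : SimpleGraph V) (a b c d : V) : Prop :=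
  G.Adj a b ∧ G.Adj b c ∧ G.Adj c d ∧ a ≠ c ∧ a ≠ d ∧ b ≠ d

def IsP4Part [DecidableEq V] (G : SimpleGraph V) (P : Finset (Sym2 V)) : Prop :=
  ∃ a b c d : V, IsP4On G a b c d ∧ P = p4Edges a b c d

/-- `D` is a partition of the edge set of `G` into parts each satisfying `allowed`. -/
def IsDecompOn [DecidableEq V] (G : SimpleGraph V)
    (allowed : Finset (Sym2 V) → Prop) (D : Finset (Finset (Sym2 V))) : Prop :=
  (∀ P ∈ D, allowed P) ∧
  (D : Set (Finset (Sym2 V))).PairwiseDisjoint id ∧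
  ∀ e : Sym2 V, e ∈ G.edgeSet ↔ ∃ P ∈ D, e ∈ P

/-- The vertices incident with at least two edges of `P`. -/
def innerVertices [Fintype V] [DecidableEq V] (P : Finset (Sym2 V)) : Finset V :=
  Finset.univ.filter fun v => 1 < (P.filter (v ∈ ·)).card

lemma mem_innerVertices [Fintype V] [DecidableEq V] {P : Finset (Sym2 V)} {v a b : V}
    (ha : s(v, a) ∈ P) (hb : s(v, b) ∈ P) (hab : a ≠ b) : v ∈ innerVertices P := by
  refine Finset.mem_filter.2 ⟨Finset.mem_univ v,
    Finset.one_lt_card.2 ⟨s(v, a), ?_, s(v, b), ?_, ?_⟩⟩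
  · simp [ha]
  · simp [hb]
  · exact fun h => hab (Sym2.congr_right.1 h)

lemma IsTrianglePart.card_eq [DecidableEq V] {G : SimpleGraph V} {P : Finset (Sym2 V)}
    (h : IsTrianglePart G P) : P.card = 3 := by
  obtain ⟨u, v, w, ⟨huv, hvw, huw⟩, rfl⟩ := h
  exact Finset.card_eq_three.2 ⟨_, _, _, by simp [huv.ne, huw.ne],
    by simp [hvw.ne, huw.ne], by simp [hvw.ne, huv.ne'], rfl⟩

lemma IsP4Part.card_eq [DecidableEq V] {G : SimpleGraph V} {P : Finset (Sym2 V)}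
    (h : IsP4Part G P) : P.card = 3 := by
  obtain ⟨a, b, c, d, ⟨hab, hbc, hcd, hac, had, hbd⟩, rfl⟩ := h
  exact Finset.card_eq_three.2 ⟨_, _, _, by simp [hab.ne, hac],
    by simp [hac, had], by simp [hbc.ne, hbd], rfl⟩

lemma IsTrianglePart.three_le_card_innerVertices [Fintype V] [DecidableEq V]
    {G : SimpleGraph V} {P : Finset (Sym2 V)} (h : IsTrianglePart G P) :
    3 ≤ (innerVertices P).card := by
  obtain ⟨u, v, w, ⟨huv, hvw, huw⟩, rfl⟩ := h
  rw [← Finset.card_eq_three.2 ⟨u, v, w, huv.ne, huw.ne, hvw.ne, rfl⟩]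
  refine Finset.card_le_card ?_
  simp only [Finset.insert_subset_iff, Finset.singleton_subset_iff]
  exact ⟨mem_innerVertices (a := v) (b := w) (by simp [triEdges]) (by simp [triEdges]) hvw.ne,
    mem_innerVertices (a := u) (b := w) (by simp [triEdges]) (by simp [triEdges]) huw.ne,
    mem_innerVertices (a := u) (b := v) (by simp [triEdges]) (by simp [triEdges]) huv.ne⟩

lemma IsP4Part.two_le_card_innerVertices [Fintype V] [DecidableEq V]
    {G : SimpleGraph V} {P : Finset (Sym2 V)} (h : IsP4Part G P) :
    2 ≤ (innerVertices P).card := by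
  obtain ⟨a, b, c, d, ⟨-, hbc, -, hac, -, hbd⟩, rfl⟩ := h
  rw [← Finset.card_pair hbc.ne]
  refine Finset.card_le_card ?_
  simp only [Finset.insert_subset_iff, Finset.singleton_subset_iff]
  exact ⟨mem_innerVertices (a := a) (b := c) (by simp [p4Edges]) (by simp [p4Edges]) hac,
    mem_innerVertices (a := b) (b := d) (by simp [p4Edges]) (by simp [p4Edges]) hbd⟩

/-- Edge-disjoint subgraphs share no inner vertex when the maximum degree is at most three. -/
lemma disjoint_innerVertices [Fintype V] [DecidableEq V] {G : SimpleGraph V}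
    [DecidableRel G.Adj] (hdeg : ∀ v, G.degree v ≤ 3) {P Q : Finset (Sym2 V)}
    (hP : P ⊆ G.edgeFinset) (hQ : Q ⊆ G.edgeFinset) (hPQ : Disjoint P Q) :
    Disjoint (innerVertices P) (innerVertices Q) := by
  refine Finset.disjoint_left.2 fun v hvP hvQ => ?_
  have h₁ := (Finset.mem_filter.1 hvP).2
  have h₂ := (Finset.mem_filter.1 hvQ).2
  have hsub : P.filter (v ∈ ·) ∪ Q.filter (v ∈ ·) ⊆ G.incidenceFinset v := by
    rw [G.incidenceFinset_eq_filter v, ← Finset.filter_union]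
    exact Finset.filter_subset_filter _ (Finset.union_subset hP hQ)
  have hcard := Finset.card_le_card hsub
  rw [Finset.card_union_of_disjoint (Finset.disjoint_filter_filter hPQ),
    G.card_incidenceFinset_eq_degree] at hcard
  have := hdeg v
  omega

/-- In any {K₃, P₄}-decomposition of a connected cubic graph, no part is a
triangle, i.e. every part is a path P₄. -/
theorem stmt_0 [Fintype V] [DecidableEq V] (G : SimpleGraph V)
    (hconn : G.Connected) (hcubic : ∀ v : V, (G.neighborSet v).ncard = 3)
    (D : Finset (Finset (Sym2 V)))
    (hD : IsDecompOn G (fun P => IsTrianglePart G P ∨ IsP4Part G P) D) :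
    ∀ P ∈ D, ¬ IsTrianglePart G P ∧ IsP4Part G P := by
  classical
  obtain ⟨hparts, hdisj, hcover⟩ := hD
  have hdeg : ∀ v, G.degree v = 3 := fun v => by
    rw [← hcubic v, ← G.card_neighborSet_eq_degree, Set.ncard_eq_toFinset_card',
      Set.toFinset_card]
  have hsub : ∀ P ∈ D, P ⊆ G.edgeFinset := fun P hP e he =>
    G.mem_edgeFinset.2 ((hcover e).2 ⟨P, hP, he⟩)
  have hunion : G.edgeFinset = D.biUnion id := by
    ext e
    simp [hcover e]
  have hedges : G.edgeFinset.card = 3 * D.card := by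
    rw [hunion, Finset.card_biUnion hdisj, Finset.sum_const_nat (m := 3), mul_comm]
    exact fun P hP => (hparts P hP).elim IsTrianglePart.card_eq IsP4Part.card_eq
  have hverts : 3 * Fintype.card V = 2 * G.edgeFinset.card := by
    rw [← G.sum_degrees_eq_twice_card_edges, Finset.sum_const_nat (m := 3) fun v _ => hdeg v,
      Finset.card_univ, mul_comm]
  have hinner : ∑ P ∈ D, (innerVertices P).card ≤ Fintype.card V := by
    rw [← Finset.card_biUnion fun P hP Q hQ hPQ =>
      disjoint_innerVertices (fun v => (hdeg v).le) (hsub P hP) (hsub Q hQ) (hdisj hP hQ hPQ)]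
    exact Finset.card_le_univ _
  have htwo : ∀ P ∈ D, 2 ≤ (innerVertices P).card := fun P hP =>
    (hparts P hP).elim (fun h => (Nat.le_succ 2).trans h.three_le_card_innerVertices)
      IsP4Part.two_le_card_innerVertices
  intro P hP
  have hnot : ¬ IsTrianglePart G P := fun hT => by
    have hlt : ∑ _Q ∈ D, 2 < ∑ Q ∈ D, (innerVertices Q).card :=
      Finset.sum_lt_sum htwo ⟨P, hP, hT.three_le_card_innerVertices⟩
    rw [Finset.sum_const, smul_eq_mul] at hlt
    omega
  exact ⟨hnot, (hparts P hP).resolve_left hnot⟩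
end

section
/- Let G be a connected cubic graph that admits a {K_3, P_4}-decomposition D. Then no vertex of G is incident to three distinct P_4 parts of D; equivalently, every vertex of G is incident to exactly one or exactly two parts of D that are paths P_4. -/
open SimpleGraph

variable {V : Type*}

open Finset in
/-- The number of edges of `P` that contain `v`. -/
def partDegree [DecidableEq V] (P : Finset (Sym2 V)) (v : V) : ℕ :=
  #{e ∈ P | v ∈ e}

lemma partDegree_insert [DecidableEq V] {P : Finset (Sym2 V)} {a b : V} (hab : s(a, b) ∉ P)
    (v : V) :
    partDegree (insert s(a, b) P) v = (if v = a ∨ v = b then 1 else 0) + partDegree P v := by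
  unfold partDegree
  simp only [Finset.filter_insert, Sym2.mem_iff]
  split_ifs
  · rw [Finset.card_insert_of_notMem (by simp [hab]), add_comm]
  · rw [zero_add]

lemma partDegree_pos_iff [DecidableEq V] {P : Finset (Sym2 V)} {v : V} :
    0 < partDegree P v ↔ ∃ e ∈ P, v ∈ e := by
  simp [partDegree, Finset.card_pos, Finset.filter_nonempty_iff]

lemma partDegree_p4Edges [DecidableEq V] {G : SimpleGraph V} {a b c d : V}
    (h : IsP4On G a b c d) (v : V) :
    partDegree (p4Edges a b c d) v =
      if v = a ∨ v = d then 1 else if v = b ∨ v = c then 2 else 0 := by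
  obtain ⟨hab, hbc, hcd, hac, had, hbd⟩ := h
  have hab := hab.ne
  have hbc := hbc.ne
  have hcd := hcd.ne
  rw [p4Edges, partDegree_insert (by simp; grind), partDegree_insert (by simp; grind),
    ← insert_empty_eq, partDegree_insert (by simp)]
  simp only [partDegree, Finset.filter_empty, Finset.card_empty]
  grind

lemma partDegree_triEdges [DecidableEq V] {G : SimpleGraph V} {a b c : V}
    (h : IsTriangleOn G a b c) (v : V) :
    partDegree (triEdges a b c) v = if v = a ∨ v = b ∨ v = c then 2 else 0 := by
  obtain ⟨hab, hbc, hac⟩ := h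
  have hab := hab.ne
  have hbc := hbc.ne
  have hac := hac.ne
  rw [triEdges, partDegree_insert (by simp; grind), partDegree_insert (by simp; grind),
    ← insert_empty_eq, partDegree_insert (by simp)]
  simp only [partDegree, Finset.filter_empty, Finset.card_empty]
  grind

open Finset in
lemma IsP4Part.card_partDegree_eq_one [Fintype V] [DecidableEq V] {G : SimpleGraph V}
    {P : Finset (Sym2 V)} (h : IsP4Part G P) : #{v | partDegree P v = 1} = 2 := by
  obtain ⟨a, b, c, d, h, rfl⟩ := h
  refine Eq.trans ?_ (card_pair h.2.2.2.2.1)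
  congr 1
  ext v
  simp only [partDegree_p4Edges h, mem_filter_univ, mem_insert, mem_singleton]
  grind

open Finset in
lemma IsP4Part.card_partDegree_eq_two [Fintype V] [DecidableEq V] {G : SimpleGraph V}
    {P : Finset (Sym2 V)} (h : IsP4Part G P) : #{v | partDegree P v = 2} = 2 := by
  obtain ⟨a, b, c, d, h, rfl⟩ := h
  refine Eq.trans ?_ (card_pair h.2.1.ne)
  congr 1
  ext v
  have := h.1.ne
  have := h.2.2.1.ne
  have := h.2.2.2
  simp only [partDegree_p4Edges h, mem_filter_univ, mem_insert, mem_singleton]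
  grind

lemma IsP4Part.partDegree_le_two [DecidableEq V] {G : SimpleGraph V}
    {P : Finset (Sym2 V)} (h : IsP4Part G P) (v : V) : partDegree P v ≤ 2 := by
  obtain ⟨a, b, c, d, h, rfl⟩ := h
  rw [partDegree_p4Edges h]
  split_ifs <;> simp

lemma IsTrianglePart.partDegree_eq [DecidableEq V] {G : SimpleGraph V}
    {P : Finset (Sym2 V)} (h : IsTrianglePart G P) (v : V) :
    partDegree P v = 0 ∨ partDegree P v = 2 := by
  obtain ⟨a, b, c, h, rfl⟩ := h
  rw [partDegree_triEdges h]
  split_ifs <;> simp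

/-- The part degrees at a vertex of a decomposition add up to the degree. -/
lemma IsDecompOn.sum_partDegree [Finite V] [DecidableEq V] {G : SimpleGraph V}
    {allowed : Finset (Sym2 V) → Prop} {D : Finset (Finset (Sym2 V))}
    (hD : IsDecompOn G allowed D) (v : V) :
    ∑ P ∈ D, partDegree P v = (G.neighborSet v).ncard := by
  classical
  have := Fintype.ofFinite V
  obtain ⟨-, hdisj, hcover⟩ := hD
  have hinc : G.incidenceFinset v = D.biUnion fun P => P.filter (v ∈ ·) := by
    ext e
    simp only [mem_incidenceFinset, incidenceSet, Set.mem_ofPred_eq, hcover, Finset.mem_biUnion,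
      Finset.mem_filter]
    tauto
  rw [Set.ncard_eq_toFinset_card', Set.toFinset_card, card_neighborSet_eq_degree,
    ← card_incidenceFinset_eq_degree, hinc, Finset.card_biUnion]
  · rfl
  · intro P hP Q hQ hPQ
    exact Finset.disjoint_filter_filter (hdisj hP hQ hPQ)

open Finset in
/-- In a `{K₃, P₄}`-decomposition of a cubic graph, every vertex is incident to exactly two
`P₄` parts. -/
lemma IsDecompOn.ncard_p4Parts_eq_two [Finite V] [DecidableEq V] {G : SimpleGraph V}
    (hcubic : ∀ v : V, (G.neighborSet v).ncard = 3) {D : Finset (Finset (Sym2 V))}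
    (hD : IsDecompOn G (fun P => IsTrianglePart G P ∨ IsP4Part G P) D) (v : V) :
    {P : Finset (Sym2 V) | P ∈ D ∧ IsP4Part G P ∧ ∃ e ∈ P, v ∈ e}.ncard = 2 := by
  classical
  have := Fintype.ofFinite V
  let ends (v : V) := #{P ∈ D | IsP4Part G P ∧ partDegree P v = 1}
  let inner (v : V) := #{P ∈ D | IsP4Part G P ∧ partDegree P v = 2}
  let tri (v : V) := #{P ∈ D | ¬ IsP4Part G P ∧ partDegree P v = 2}
  have hdeg (v : V) : ends v + 2 * inner v + 2 * tri v = 3 := by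
    rw [← hcubic v, ← hD.sum_partDegree v]
    simp only [ends, inner, tri, card_filter, mul_sum, ← sum_add_distrib]
    refine sum_congr rfl fun P hP => ?_
    by_cases h : IsP4Part G P
    · have := h.partDegree_le_two v
      simp only [h, true_and, not_true, false_and, if_false]
      split_ifs <;> omega
    · have := ((hD.1 P hP).resolve_right h).partDegree_eq v
      simp only [h, false_and, not_false_eq_true, true_and, if_false]
      split_ifs <;> omega
  have hsum : ∑ v, inner v = ∑ v, ends v := by
    simp only [ends, inner, card_filter]
    rw [sum_comm, sum_comm (s := univ)]
    refine sum_congr rfl fun P _ => ?_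
    simp only [← card_filter]
    by_cases h : IsP4Part G P
    · simp [h, h.card_partDegree_eq_one, h.card_partDegree_eq_two]
    · simp [h]
  have hle : ∀ v ∈ univ, inner v ≤ ends v := fun v _ => by have := hdeg v; omega
  have heq := (sum_eq_sum_iff_of_le hle).1 hsum v (mem_univ v)
  have hset : {P : Finset (Sym2 V) | P ∈ D ∧ IsP4Part G P ∧ ∃ e ∈ P, v ∈ e} =
      ({P ∈ D | IsP4Part G P ∧ partDegree P v = 1} ∪
        {P ∈ D | IsP4Part G P ∧ partDegree P v = 2} : Finset (Finset (Sym2 V))) := by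
    ext P
    simp only [Set.mem_ofPred_eq, coe_union, coe_filter, Set.mem_union, ← partDegree_pos_iff,
      ← and_or_left]
    refine and_congr_right fun _ => and_congr_right fun h => ?_
    have := h.partDegree_le_two v
    omega
  rw [hset, Set.ncard_coe_finset, card_union_of_disjoint]
  · change ends v + inner v = 2
    have := hdeg v
    omega
  · refine disjoint_filter.2 fun P _ h₁ h₂ => ?_
    omega

/-- In any {K₃, P₄}-decomposition of a connected cubic graph, no vertex is
incident to three distinct P₄ parts; equivalently every vertex is incident to
exactly one or exactly two P₄ parts. -/
theorem stmt_1 [Fintype V] [DecidableEq V] (G : SimpleGraph V)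
    (hconn : G.Connected) (hcubic : ∀ v : V, (G.neighborSet v).ncard = 3)
    (D : Finset (Finset (Sym2 V)))
    (hD : IsDecompOn G (fun P => IsTrianglePart G P ∨ IsP4Part G P) D) :
    ∀ v : V,
      (¬ ∃ P₁ P₂ P₃ : Finset (Sym2 V), P₁ ∈ D ∧ P₂ ∈ D ∧ P₃ ∈ D ∧
        P₁ ≠ P₂ ∧ P₁ ≠ P₃ ∧ P₂ ≠ P₃ ∧
        IsP4Part G P₁ ∧ IsP4Part G P₂ ∧ IsP4Part G P₃ ∧
        (∃ e ∈ P₁, v ∈ e) ∧ (∃ e ∈ P₂, v ∈ e) ∧ (∃ e ∈ P₃, v ∈ e)) ∧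
      ({P : Finset (Sym2 V) | P ∈ D ∧ IsP4Part G P ∧ ∃ e ∈ P, v ∈ e}.ncard = 1 ∨
       {P : Finset (Sym2 V) | P ∈ D ∧ IsP4Part G P ∧ ∃ e ∈ P, v ∈ e}.ncard = 2) := by
  intro v
  have h2 := hD.ncard_p4Parts_eq_two hcubic v
  refine ⟨?_, Or.inr h2⟩
  rintro ⟨P₁, P₂, P₃, m₁, m₂, m₃, h₁₂, h₁₃, h₂₃, p₁, p₂, p₃, i₁, i₂, i₃⟩
  have hsub : ({P₁, P₂, P₃} : Set (Finset (Sym2 V))) ⊆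
      {P : Finset (Sym2 V) | P ∈ D ∧ IsP4Part G P ∧ ∃ e ∈ P, v ∈ e} := by
    rintro P (rfl | rfl | rfl)
    exacts [⟨m₁, p₁, i₁⟩, ⟨m₂, p₂, i₂⟩, ⟨m₃, p₃, i₃⟩]
  have hcard := Set.ncard_le_ncard hsub (Set.finite_of_ncard_ne_zero (by omega))
  rw [Set.ncard_eq_three.2 ⟨P₁, P₂, P₃, h₁₂, h₁₃, h₂₃, rfl⟩] at hcard
  omega
end

section
/- A connected cubic graph admits a {P_4}-decomposition (a partition of its edge set into paths with three edges each) if and only if it has a perfect matching. -/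
open SimpleGraph

variable {V : Type*}

section

variable [DecidableEq V] {G : SimpleGraph V}

/-- A 2-regular finite graph has an orientation in which every vertex has out-degree one; it is
given by the map sending each vertex to its successor. -/
theorem exists_successor_of_two_regular [Fintype V] [DecidableRel G.Adj] (h : ∀ v, G.degree v = 2) :
    ∃ σ : V → V, (∀ v, G.Adj v (σ v)) ∧ (∀ v, σ (σ v) ≠ v) ∧ Function.Injective σ ∧
      ∀ x y, G.Adj x y → y = σ x ∨ x = σ y := by
  have hall : ∀ S : Finset V, S.card ≤ (S.biUnion fun v => G.incidenceFinset v).card := by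
    intro S
    have := Finset.card_mul_le_card_mul (s := S) (t := S.biUnion fun v => G.incidenceFinset v)
      (fun v e => v ∈ e) (m := 2) (n := 2) ?_ ?_
    · omega
    · intro v hv
      rw [← h v, ← G.card_incidenceFinset_eq_degree]
      refine Finset.card_le_card fun e he => ?_
      simp only [Finset.mem_bipartiteAbove, Finset.mem_biUnion]
      exact ⟨⟨v, hv, he⟩, ((G.mem_incidenceFinset v e).1 he).2⟩
    · intro e _
      induction e with | _ x y
      refine (Finset.card_le_card (t := {x, y}) fun v hv => ?_).trans Finset.card_le_two
      simpa using ((Finset.mem_bipartiteBelow _).1 hv).2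
  obtain ⟨f, hf, hfm⟩ := (Finset.all_card_le_biUnion_card_iff_exists_injective _).1 hall
  have hex : ∀ v, ∃ w, G.Adj v w ∧ f v = s(v, w) := by
    intro v
    have hv := (G.mem_incidenceFinset v _).1 (hfm v)
    obtain ⟨w, hw⟩ := Sym2.mem_iff_exists.1 hv.2
    exact ⟨w, by simpa [hw] using hv.1, hw⟩
  choose σ hσ hfσ using hex
  have hσσ : ∀ v, σ (σ v) ≠ v := fun v hv => by
    have : σ v = v := hf (by rw [hfσ, hfσ, hv, Sym2.eq_swap])
    exact (hσ v).ne this.symm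
  have two : ∀ x a b c, G.Adj x a → G.Adj x b → G.Adj x c → a ≠ b → c = a ∨ c = b := by
    intro x a b c ha hb hc hab
    have hs : ({a, b} : Finset V) = G.neighborFinset x := by
      refine Finset.eq_of_subset_of_card_le ?_ ?_
      · intro z hz
        simp only [Finset.mem_insert, Finset.mem_singleton] at hz
        rcases hz with rfl | rfl <;> simpa
      · rw [G.card_neighborFinset_eq_degree, h, Finset.card_pair hab]
    have : c ∈ ({a, b} : Finset V) := by rw [hs]; simpa
    simpa using this
  have hinj : Function.Injective σ := by
    intro v w hvw
    by_contra hne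
    rcases two (σ v) v w (σ (σ v)) (hσ v).symm (hvw ▸ (hσ w).symm) (hσ _) hne with h1 | h1
    · exact hσσ v h1
    · exact hσσ w (hvw ▸ h1)
  refine ⟨σ, hσ, hσσ, hinj, fun x y hxy => ?_⟩
  obtain ⟨z, rfl⟩ := Finite.surjective_of_injective hinj x
  rcases two (σ z) (σ (σ z)) z y (hσ _) (hσ z).symm hxy (hσσ z) with h1 | h1
  · exact Or.inl h1
  · exact Or.inr (by rw [h1])

theorem exists_p4_decomp_of_successor [Fintype V] {m σ : V → V} (hm : ∀ v, G.Adj v (m v))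
    (hmm : ∀ v, m (m v) = v) (hσ : ∀ v, G.Adj v (σ v)) (hσm : ∀ v, σ v ≠ m v)
    (hσσ : ∀ v, σ (σ v) ≠ v) (hinj : Function.Injective σ)
    (hcov : ∀ x y, G.Adj x y → y = m x ∨ y = σ x ∨ x = σ y) :
    ∃ D : Finset (Finset (Sym2 V)), IsDecompOn G (IsP4Part G) D := by
  have hmem : ∀ e v, e ∈ p4Edges (σ v) v (m v) (σ (m v)) ↔
      e = s(v, m v) ∨ e = s(v, σ v) ∨ e = s(m v, σ (m v)) := by
    intro e v
    simp only [p4Edges, Finset.mem_insert, Finset.mem_singleton, Sym2.eq_swap (a := σ v)]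
    tauto
  refine ⟨Finset.univ.image fun v => p4Edges (σ v) v (m v) (σ (m v)), ?_, ?_, ?_⟩
  · intro P hP
    obtain ⟨v, -, rfl⟩ := Finset.mem_image.1 hP
    refine ⟨σ v, v, m v, σ (m v), ⟨(hσ v).symm, hm v, hσ _, hσm v, ?_, ?_⟩, rfl⟩
    · exact fun h => (hm v).ne (hinj h)
    · intro h
      exact hσm (m v) (by rw [hmm, ← h])
  · intro P hP Q hQ hPQ
    simp only [Finset.coe_image, Finset.coe_univ, Set.image_univ, Set.mem_range] at hP hQ
    obtain ⟨v, rfl⟩ := hP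
    obtain ⟨w, rfl⟩ := hQ
    refine Finset.disjoint_left.2 fun e he he' => hPQ ?_
    have key : w = v ∨ w = m v := by
      have hσi : ∀ x y, s(x, σ x) = s(y, σ y) → x = y := by
        intro x y h
        rcases Sym2.eq_iff.1 h with h | h
        · exact h.1
        · exact absurd (h.2 ▸ h.1.symm) (hσσ x)
      have hmσ : ∀ x y, s(x, m x) ≠ s(y, σ y) := by
        intro x y h
        rcases Sym2.eq_iff.1 h with ⟨h1, h2⟩ | ⟨h1, h2⟩
        · exact hσm y (by rw [← h2, h1])
        · exact hσm y (by rw [← h1, ← h2, hmm])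
      simp only [id, hmem] at he he'
      rcases he with rfl | rfl | rfl <;> rcases he' with h | h | h
      · rcases Sym2.eq_iff.1 h with h | h
        · exact Or.inl h.1.symm
        · exact Or.inr h.2.symm
      · exact absurd h (hmσ _ _)
      · exact absurd h (hmσ _ _)
      · exact absurd h.symm (hmσ _ _)
      · exact Or.inl (hσi _ _ h).symm
      · exact Or.inr (by rw [hσi _ _ h, hmm])
      · exact absurd h.symm (hmσ _ _)
      · exact Or.inr (hσi _ _ h).symm
      · exact Or.inl (by rw [← hmm w, ← hσi _ _ h, hmm])
    rcases key with rfl | rfl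
    · rfl
    · ext e
      rw [hmem, hmem, hmm, Sym2.eq_swap (a := m v) (b := v)]
      tauto
  · intro e
    simp only [Finset.mem_image, Finset.mem_univ, true_and, exists_exists_eq_and, hmem]
    constructor
    · induction e with | _ x y
      intro h
      rcases hcov x y h with rfl | rfl | rfl
      · exact ⟨x, Or.inl rfl⟩
      · exact ⟨x, Or.inr (Or.inl rfl)⟩
      · exact ⟨y, Or.inr (Or.inl Sym2.eq_swap)⟩
    · rintro ⟨v, rfl | rfl | rfl⟩
      · exact hm v
      · exact hσ v
      · exact hσ _

theorem exists_p4_decomp_of_isPerfectMatching [Fintype V] [DecidableRel G.Adj]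
    (h : ∀ v, G.degree v = 3)
    {M : G.Subgraph} (hM : M.IsPerfectMatching) :
    ∃ D : Finset (Finset (Sym2 V)), IsDecompOn G (IsP4Part G) D := by
  classical
  have hM' := Subgraph.isPerfectMatching_iff.1 hM
  choose m hm hmu using hM'
  have hmm : ∀ v, m (m v) = v := fun v => (hmu (m v) v (hm v).symm).symm
  have hH : ∀ v w, (G \ M.spanningCoe).Adj v w ↔ G.Adj v w ∧ w ≠ m v := by
    intro v w
    rw [sdiff_adj, Subgraph.spanningCoe_adj]
    exact and_congr_right fun _ => not_congr ⟨hmu v w, fun h => h ▸ hm v⟩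
  have hdeg : ∀ v, (G \ M.spanningCoe).degree v = 2 := by
    intro v
    have : (G \ M.spanningCoe).neighborFinset v = (G.neighborFinset v).erase (m v) := by
      ext w
      rw [mem_neighborFinset, hH, Finset.mem_erase, mem_neighborFinset, and_comm]
    rw [← card_neighborFinset_eq_degree, this, Finset.card_erase_of_mem
      ((G.mem_neighborFinset _ _).2 (hm v).adj_sub), card_neighborFinset_eq_degree, h]
  obtain ⟨σ, h1, h2, h3, h4⟩ := exists_successor_of_two_regular hdeg
  refine exists_p4_decomp_of_successor (m := m) (σ := σ) (fun v => (hm v).adj_sub) hmm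
    (fun v => ((hH _ _).1 (h1 v)).1) (fun v => ((hH _ _).1 (h1 v)).2) h2 h3 fun x y hxy => ?_
  by_cases hy : y = m x
  · exact Or.inl hy
  · exact Or.inr (h4 x y ((hH _ _).2 ⟨hxy, hy⟩))

theorem IsP4Part.exists_inner {P : Finset (Sym2 V)} (hP : IsP4Part G P) :
    ∃ i : Bool → V, G.Adj (i true) (i false) ∧ P.card = 3 ∧
      ∀ t, 2 ≤ (P.filter (i t ∈ ·)).card := by
  obtain ⟨a, b, c, d, ⟨hab, hbc, hcd, hac, had, hbd⟩, rfl⟩ := hP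
  have h1 : s(a, b) ≠ s(b, c) := by simp [hab.ne, hac]
  have h2 : s(b, c) ≠ s(c, d) := by simp [hbc.ne, hbd]
  have h3 : s(a, b) ≠ s(c, d) := by simp [hac, had]
  refine ⟨fun t => bif t then b else c, hbc, ?_, ?_⟩
  · exact Finset.card_eq_three.2 ⟨_, _, _, h1, h3, h2, rfl⟩
  · rintro (_ | _)
    · rw [← Finset.card_pair h2]
      refine Finset.card_le_card ?_
      simp [p4Edges, Finset.insert_subset_iff]
    · rw [← Finset.card_pair h1]
      refine Finset.card_le_card ?_
      simp [p4Edges, Finset.insert_subset_iff]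

theorem IsDecompOn.exists_isPerfectMatching [Fintype V] [DecidableRel G.Adj]
    (h : ∀ v, G.degree v = 3) {D : Finset (Finset (Sym2 V))} (hD : IsDecompOn G (IsP4Part G) D) :
    ∃ M : G.Subgraph, M.IsPerfectMatching := by
  obtain ⟨hpart, hdisj, hcov⟩ := hD
  have hex : ∀ P : D, ∃ i : Bool → V, G.Adj (i true) (i false) ∧ P.1.card = 3 ∧
      ∀ t, 2 ≤ (P.1.filter (i t ∈ ·)).card := fun P => (hpart P.1 P.2).exists_inner
  choose i hadj hcard htwo using hex
  have hadj' : ∀ P t, G.Adj (i P t) (i P !t) := by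
    rintro P (_ | _)
    · exact (hadj P).symm
    · exact hadj P
  have hinj : Function.Injective fun p : D × Bool => i p.1 p.2 := by
    rintro ⟨P, s⟩ ⟨Q, t⟩ (hv : i P s = i Q t)
    by_cases hPQ : P = Q
    · subst hPQ
      by_cases hst : s = t
      · rw [hst]
      · have := hadj' P s
        rw [show (!s) = t by cases s <;> cases t <;> simp_all, hv] at this
        exact absurd this (G.loopless.irrefl _)
    · have hdis : Disjoint P.1 Q.1 := hdisj P.2 Q.2 fun h => hPQ (Subtype.ext h)
      have h1 := htwo P s
      have h2 := htwo Q t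
      rw [← hv] at h2
      have h3 : (P.1.filter (i P s ∈ ·) ∪ Q.1.filter (i P s ∈ ·)).card ≤ 3 := by
        rw [← h (i P s), ← card_incidenceFinset_eq_degree]
        refine Finset.card_le_card fun e he => ?_
        rw [← Finset.filter_union, Finset.mem_filter, Finset.mem_union] at he
        rw [mem_incidenceFinset]
        exact ⟨(hcov e).2 (he.1.elim (fun h => ⟨_, P.2, h⟩) fun h => ⟨_, Q.2, h⟩), he.2⟩
      rw [Finset.card_union_of_disjoint (Finset.disjoint_filter_filter hdis)] at h3
      omega
  have hE : G.edgeFinset.card = D.card * 3 := by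
    have : G.edgeFinset = D.biUnion id := by
      ext e
      simp [hcov]
    rw [this, Finset.card_biUnion hdisj]
    exact Finset.sum_const_nat fun P hP => hcard ⟨P, hP⟩
  have hV : Fintype.card V * 3 = 2 * G.edgeFinset.card := by
    rw [← G.sum_degrees_eq_twice_card_edges, Finset.sum_const_nat fun v _ => h v,
      Finset.card_univ]
  have hbij := (Fintype.bijective_iff_injective_and_card _).2
    ⟨hinj, by simp only [Fintype.card_prod, Fintype.card_coe, Fintype.card_bool]; omega⟩
  refine ⟨⟨Set.univ, fun x y => ∃ P t, x = i P t ∧ y = i P !t, ?_, fun _ => trivial, ⟨?_⟩⟩, ?_⟩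
  · rintro x y ⟨P, t, rfl, rfl⟩
    exact hadj' P t
  · rintro x y ⟨P, t, rfl, rfl⟩
    exact ⟨P, !t, rfl, by simp⟩
  · rw [Subgraph.isPerfectMatching_iff]
    intro v
    obtain ⟨⟨P, t⟩, rfl⟩ := hbij.2 v
    refine ⟨i P !t, ⟨P, t, rfl, rfl⟩, ?_⟩
    rintro y ⟨Q, s, hQ, rfl⟩
    obtain ⟨rfl, rfl⟩ := Prod.mk.inj (hinj (a₁ := (P, t)) (a₂ := (Q, s)) hQ)
    rfl

end

/-- A connected cubic graph admits a {P₄}-decomposition iff it has a perfect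
matching. -/
theorem stmt_3 [Fintype V] [DecidableEq V] (G : SimpleGraph V)
    (hconn : G.Connected) (hcubic : ∀ v : V, (G.neighborSet v).ncard = 3) :
    (∃ D : Finset (Finset (Sym2 V)), IsDecompOn G (IsP4Part G) D) ↔
      ∃ M : G.Subgraph, M.IsPerfectMatching := by
  classical
  have h : ∀ v, G.degree v = 3 := fun v => by
    rw [← hcubic v, ← card_neighborFinset_eq_degree, ← Set.ncard_coe_finset, coe_neighborFinset]
  exact ⟨fun ⟨_, hD⟩ => hD.exists_isPerfectMatching h,
    fun ⟨_, hM⟩ => exists_p4_decomp_of_isPerfectMatching h hM⟩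
end

section
/- A connected cubic graph admits a {K_{1,3}}-decomposition if and only if it is bipartite. Moreover, in any {K_{1,3}}-decomposition of a connected cubic graph, the set of centers of the claws and the set of vertices occurring as leaves of claws form a bipartition of the vertex set. -/
open SimpleGraph

variable {V : Type*}

/-- `v` is the center of some claw part of `D`. -/
def IsClawCenter [DecidableEq V] (G : SimpleGraph V)
    (D : Finset (Finset (Sym2 V))) (v : V) : Prop :=
  ∃ P ∈ D, ∃ a b d : V, a ≠ b ∧ a ≠ d ∧ b ≠ d ∧
    G.Adj v a ∧ G.Adj v b ∧ G.Adj v d ∧ P = clawEdges v a b d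

/-- `v` occurs as a leaf of some claw part of `D`. -/
def IsClawLeaf [DecidableEq V] (G : SimpleGraph V)
    (D : Finset (Finset (Sym2 V))) (v : V) : Prop :=
  ∃ P ∈ D, ∃ c a b d : V, a ≠ b ∧ a ≠ d ∧ b ≠ d ∧
    G.Adj c a ∧ G.Adj c b ∧ G.Adj c d ∧ P = clawEdges c a b d ∧
    (v = a ∨ v = b ∨ v = d)

theorem mem_clawEdges_of_neighborSet_eq [DecidableEq V] {G : SimpleGraph V} {c a b d : V}
    (h : G.neighborSet c = {a, b, d}) (e : Sym2 V) :
    e ∈ clawEdges c a b d ↔ ∃ w, G.Adj c w ∧ e = s(c, w) := by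
  have h' : ∀ w, G.Adj c w ↔ w = a ∨ w = b ∨ w = d := fun w => by
    rw [← G.mem_neighborSet, h]; simp
  simp [clawEdges, h', or_and_right, exists_or]

theorem neighborSet_eq_of_ncard_eq_three [Finite V] {G : SimpleGraph V} {c a b d : V}
    (h : (G.neighborSet c).ncard = 3) (hab : a ≠ b) (had : a ≠ d) (hbd : b ≠ d)
    (ha : G.Adj c a) (hb : G.Adj c b) (hd : G.Adj c d) :
    G.neighborSet c = {a, b, d} := by
  symm
  apply Set.eq_of_subset_of_ncard_le
  · rintro x (rfl | rfl | rfl) <;> assumption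
  · rw [h, Set.ncard_eq_three.2 ⟨a, b, d, hab, had, hbd, rfl⟩]
  · exact Set.toFinite _

theorem IsDecompOn.not_isClawCenter_and_isClawLeaf [Finite V] [DecidableEq V] {G : SimpleGraph V}
    (hcubic : ∀ v : V, (G.neighborSet v).ncard = 3) {D : Finset (Finset (Sym2 V))}
    (hD : IsDecompOn G (IsClawPart G) D) (v : V) :
    ¬ (IsClawCenter G D v ∧ IsClawLeaf G D v) := by
  rintro ⟨⟨P, hP, a, b, d, hab, had, hbd, ha, hb, hd, rfl⟩,
    Q, hQ, c, a', b', d', -, -, -, ha', hb', hd', rfl, hv⟩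
  have hN := neighborSet_eq_of_ncard_eq_three (hcubic v) hab had hbd ha hb hd
  have hcv : G.Adj c v := by rcases hv with rfl | rfl | rfl <;> assumption
  have hvQ : s(c, v) ∈ clawEdges c a' b' d' := by
    rcases hv with rfl | rfl | rfl <;> simp [clawEdges]
  have hvP : s(c, v) ∈ clawEdges v a b d :=
    (mem_clawEdges_of_neighborSet_eq hN _).2 ⟨c, hcv.symm, Sym2.eq_swap⟩
  have hPQ : clawEdges v a b d = clawEdges c a' b' d' := by
    by_contra hne
    exact Finset.disjoint_left.1 (hD.2.1 hP hQ hne) hvP hvQ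
  have hmem : ∀ w, G.Adj v w → w = c := by
    intro w hw
    have hwQ : s(v, w) ∈ clawEdges c a' b' d' :=
      hPQ ▸ (mem_clawEdges_of_neighborSet_eq hN _).2 ⟨w, hw, rfl⟩
    have hne := hcv.ne
    simp only [clawEdges, Finset.mem_insert, Finset.mem_singleton, Sym2.eq_iff] at hwQ
    grind
  exact hab ((hmem a ha).trans (hmem b hb).symm)

theorem IsDecompOn.isClawCenter_and_isClawLeaf_of_adj [DecidableEq V] {G : SimpleGraph V}
    {D : Finset (Finset (Sym2 V))} (hD : IsDecompOn G (IsClawPart G) D) {u v : V}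
    (huv : G.Adj u v) :
    (IsClawCenter G D u ∧ IsClawLeaf G D v) ∨ (IsClawLeaf G D u ∧ IsClawCenter G D v) := by
  obtain ⟨P, hP, he⟩ := (hD.2.2 s(u, v)).1 huv
  obtain ⟨c, a, b, d, hab, had, hbd, ha, hb, hd, rfl⟩ := hD.1 P hP
  have hcenter : IsClawCenter G D c := ⟨_, hP, a, b, d, hab, had, hbd, ha, hb, hd, rfl⟩
  have hleaf : ∀ w, w = a ∨ w = b ∨ w = d → IsClawLeaf G D w := fun w hw =>
    ⟨_, hP, c, a, b, d, hab, had, hbd, ha, hb, hd, rfl, hw⟩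
  simp only [clawEdges, Finset.mem_insert, Finset.mem_singleton, Sym2.eq_iff] at he
  grind

theorem exists_isDecompOn_isClawPart_of_colorable_two [Fintype V] [DecidableEq V]
    {G : SimpleGraph V} (hcubic : ∀ v : V, (G.neighborSet v).ncard = 3) (hG : G.Colorable 2) :
    ∃ D : Finset (Finset (Sym2 V)), IsDecompOn G (IsClawPart G) D := by
  obtain ⟨C⟩ := hG
  choose a b d hab had hbd hN using fun v => Set.ncard_eq_three.1 (hcubic v)
  have hmem := fun v => mem_clawEdges_of_neighborSet_eq (hN v)
  refine ⟨(Finset.univ.filter fun v => C v = 0).image fun v => clawEdges v (a v) (b v) (d v),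
    ?_, ?_, ?_⟩
  · intro P hP
    obtain ⟨v, -, rfl⟩ := Finset.mem_image.1 hP
    have hadj : ∀ w, w ∈ ({a v, b v, d v} : Set V) → G.Adj v w := fun w hw => by
      rwa [← hN v] at hw
    exact ⟨v, a v, b v, d v, hab v, had v, hbd v, hadj _ (by simp), hadj _ (by simp),
      hadj _ (by simp), rfl⟩
  · intro P hP Q hQ hne
    obtain ⟨u, hu, rfl⟩ := Finset.mem_image.1 hP
    obtain ⟨v, hv, rfl⟩ := Finset.mem_image.1 hQ
    refine Finset.disjoint_left.2 fun e he he' => ?_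
    obtain ⟨x, hx, rfl⟩ := (hmem u e).1 he
    obtain ⟨y, hy, hxy⟩ := (hmem v _).1 he'
    rcases Sym2.eq_iff.1 hxy with ⟨rfl, -⟩ | ⟨rfl, rfl⟩
    · exact hne rfl
    · exact C.valid hx ((Finset.mem_filter.1 hu).2.trans (Finset.mem_filter.1 hv).2.symm)
  · intro e
    simp only [Finset.mem_image, Finset.mem_filter, Finset.mem_univ, true_and,
      exists_exists_and_eq_and, hmem]
    constructor
    · induction e with | _ u v
      intro (huv : G.Adj u v)
      have hne := C.valid huv
      by_cases hu : C u = 0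
      · exact ⟨u, hu, v, huv, rfl⟩
      · exact ⟨v, by omega, u, huv.symm, Sym2.eq_swap⟩
    · rintro ⟨v, -, w, hvw, rfl⟩
      exact hvw

/-- A connected cubic graph admits a {K₁,₃}-decomposition iff it is bipartite
(2-colorable); moreover in any such decomposition the claw centers and the claw
leaves form a bipartition of the vertex set. -/
theorem stmt_5 [Fintype V] [DecidableEq V] (G : SimpleGraph V)
    (hconn : G.Connected) (hcubic : ∀ v : V, (G.neighborSet v).ncard = 3) :
    ((∃ D : Finset (Finset (Sym2 V)), IsDecompOn G (IsClawPart G) D) ↔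
        G.Colorable 2) ∧
    ∀ D : Finset (Finset (Sym2 V)), IsDecompOn G (IsClawPart G) D →
      (∀ v : V, ¬ (IsClawCenter G D v ∧ IsClawLeaf G D v)) ∧
      (∀ v : V, IsClawCenter G D v ∨ IsClawLeaf G D v) ∧
      (∀ u v : V, G.Adj u v →
        (IsClawCenter G D u ∧ IsClawLeaf G D v) ∨
        (IsClawLeaf G D u ∧ IsClawCenter G D v)) := by
  refine ⟨⟨fun ⟨D, hD⟩ => ?_, exists_isDecompOn_isClawPart_of_colorable_two hcubic⟩,
    fun D hD => ⟨hD.not_isClawCenter_and_isClawLeaf hcubic, fun v => ?_,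
      fun u v => hD.isClawCenter_and_isClawLeaf_of_adj⟩⟩
  · classical
    refine (Coloring.mk (fun v => decide (IsClawCenter G D v)) fun {u v} huv heq => ?_ :
      G.Coloring Bool).colorable
    have hiff : IsClawCenter G D u ↔ IsClawCenter G D v := decide_eq_decide.1 heq
    have hu := hD.not_isClawCenter_and_isClawLeaf hcubic u
    have hv := hD.not_isClawCenter_and_isClawLeaf hcubic v
    have := hD.isClawCenter_and_isClawLeaf_of_adj huv
    tauto
  · obtain ⟨w, hw⟩ := Set.nonempty_of_ncard_ne_zero (s := G.neighborSet v) (by simp [hcubic v])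
    exact (hD.isClawCenter_and_isClawLeaf_of_adj hw).imp And.left And.left
end

section
/- Let G be a cubic graph that admits a {K_{1,3}, K_3}-decomposition D. Then every isolated triangle of G occurs as a part of D (its three edges form a single K_3 part of D). -/
open SimpleGraph

variable {V : Type*}

/-- The triangle on `u v w` is isolated: no further vertex forms a triangle with
two of its vertices. -/
def IsIsolatedTriangle (G : SimpleGraph V) (u v w : V) : Prop :=
  IsTriangleOn G u v w ∧ ∀ x : V, x ≠ u → x ≠ v → x ≠ w →
    ¬ IsTriangleOn G u v x ∧ ¬ IsTriangleOn G u x w ∧ ¬ IsTriangleOn G x v w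

/-- In a cubic graph, a claw consists of all the edges at its centre, which is an end of any
edge of the claw. -/
theorem IsClawPart.exists_center [DecidableEq V] {G : SimpleGraph V}
    (hcubic : ∀ v : V, (G.neighborSet v).ncard = 3) {P : Finset (Sym2 V)}
    (hP : IsClawPart G P) {x y : V} (hxy : s(x, y) ∈ P) :
    ∃ c, (c = x ∨ c = y) ∧ ∀ e, e ∈ P ↔ e ∈ G.incidenceSet c := by
  obtain ⟨c, a, b, d, hab, had, hbd, ha, hb, hd, rfl⟩ := hP
  have hN : ({a, b, d} : Set V) = G.neighborSet c := by
    refine Set.eq_of_subset_of_ncard_le ?_ ?_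
      (Set.finite_of_ncard_ne_zero (by rw [hcubic c]; decide))
    · rintro t (rfl | rfl | rfl) <;> assumption
    · rw [hcubic c, Set.ncard_eq_three.2 ⟨a, b, d, hab, had, hbd, rfl⟩]
  refine ⟨c, ?_, fun e => ⟨fun he => ?_, fun he => ?_⟩⟩
  · simp only [clawEdges, Finset.mem_insert, Finset.mem_singleton, Sym2.eq_iff] at hxy
    grind
  · simp only [clawEdges, Finset.mem_insert, Finset.mem_singleton] at he
    rcases he with rfl | rfl | rfl <;> simpa [SimpleGraph.incidenceSet]
  · obtain ⟨hadj, t, rfl⟩ := he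
    have ht : t ∈ ({a, b, d} : Set V) := hN ▸ hadj
    rcases ht with rfl | rfl | rfl <;> simp [clawEdges]

theorem IsTrianglePart.exists_third [DecidableEq V] {G : SimpleGraph V} {P : Finset (Sym2 V)}
    (hP : IsTrianglePart G P) {x y : V} (hxy : s(x, y) ∈ P) :
    ∃ z, G.Adj x z ∧ G.Adj y z ∧ P = triEdges x y z := by
  obtain ⟨a, b, c, ⟨hab, hbc, hac⟩, rfl⟩ := hP
  simp only [triEdges, Finset.mem_insert, Finset.mem_singleton, Sym2.eq_iff] at hxy
  rcases hxy with (⟨rfl, rfl⟩ | ⟨rfl, rfl⟩) | (⟨rfl, rfl⟩ | ⟨rfl, rfl⟩) |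
      (⟨rfl, rfl⟩ | ⟨rfl, rfl⟩)
  · exact ⟨c, hac, hbc, rfl⟩
  · exact ⟨c, hbc, hac, by ext e; simp [triEdges, Sym2.eq_swap]; tauto⟩
  · exact ⟨a, hab.symm, hac.symm, by ext e; simp [triEdges, Sym2.eq_swap]; tauto⟩
  · exact ⟨a, hac.symm, hab.symm, by ext e; simp [triEdges, Sym2.eq_swap]; tauto⟩
  · exact ⟨b, hab, hbc.symm, by ext e; simp [triEdges, Sym2.eq_swap]; tauto⟩
  · exact ⟨b, hbc.symm, hab, by ext e; simp [triEdges, Sym2.eq_swap]; tauto⟩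

/-- If the edge `yz` lies in no triangle other than `xyz`, then no part of the decomposition is
the claw centred at `x`. -/
theorem IsDecompOn.not_claw_at_vertex_of_triangle [DecidableEq V] {G : SimpleGraph V}
    (hcubic : ∀ v : V, (G.neighborSet v).ncard = 3) {D : Finset (Finset (Sym2 V))}
    (hD : IsDecompOn G (fun P => IsClawPart G P ∨ IsTrianglePart G P) D)
    {x y z : V} (hxy : G.Adj x y) (hxz : G.Adj x z) (hyz : G.Adj y z)
    (hunique : ∀ t, G.Adj y t → G.Adj z t → t = x)
    {P : Finset (Sym2 V)} (hPD : P ∈ D) (hP : ∀ e, e ∈ P ↔ e ∈ G.incidenceSet x) : False := by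
  obtain ⟨hparts, hdisj, hcover⟩ := hD
  obtain ⟨Q, hQD, hQ⟩ := (hcover s(y, z)).1 hyz
  have hne : P ≠ Q := by
    rintro rfl
    have hx := ((hP _).1 hQ).2
    rcases Sym2.mem_iff.1 hx with rfl | rfl
    · exact hxy.ne rfl
    · exact hxz.ne rfl
  have hPQ : Disjoint P Q := hdisj hPD hQD hne
  have hyP : s(y, x) ∈ P := (hP _).2 ⟨hxy.symm, Sym2.mem_mk_right y x⟩
  have hzP : s(z, x) ∈ P := (hP _).2 ⟨hxz.symm, Sym2.mem_mk_right z x⟩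
  rcases hparts Q hQD with hclaw | htri
  · obtain ⟨c, rfl | rfl, hc⟩ := hclaw.exists_center hcubic hQ
    · exact Finset.disjoint_left.1 hPQ hyP ((hc _).2 ⟨hxy.symm, Sym2.mem_mk_left _ _⟩)
    · exact Finset.disjoint_left.1 hPQ hzP ((hc _).2 ⟨hxz.symm, Sym2.mem_mk_left _ _⟩)
  · obtain ⟨t, hyt, hzt, rfl⟩ := htri.exists_third hQ
    obtain rfl := hunique t hyt hzt
    exact Finset.disjoint_left.1 hPQ hyP (by simp [triEdges])

/-- In any {K₁,₃, K₃}-decomposition of a cubic graph, every isolated triangle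
occurs as a part. -/
theorem stmt_6 [Fintype V] [DecidableEq V] (G : SimpleGraph V)
    (hcubic : ∀ v : V, (G.neighborSet v).ncard = 3)
    (D : Finset (Finset (Sym2 V)))
    (hD : IsDecompOn G (fun P => IsClawPart G P ∨ IsTrianglePart G P) D)
    (u v w : V) (h : IsIsolatedTriangle G u v w) :
    triEdges u v w ∈ D := by
  obtain ⟨⟨huv, hvw, huw⟩, hiso⟩ := h
  have hunique_uv : ∀ t, G.Adj u t → G.Adj v t → t = w := fun t hu hv => by
    by_contra htw
    exact (hiso t hu.ne' hv.ne' htw).1 ⟨huv, hv, hu⟩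
  have hunique_uw : ∀ t, G.Adj u t → G.Adj w t → t = v := fun t hu hw => by
    by_contra htv
    exact (hiso t hu.ne' htv hw.ne').2.1 ⟨hu, hw.symm, huw⟩
  have hunique_vw : ∀ t, G.Adj v t → G.Adj w t → t = u := fun t hv hw => by
    by_contra htu
    exact (hiso t htu hv.ne' hw.ne').2.2 ⟨hv.symm, hvw, hw.symm⟩
  obtain ⟨P, hPD, hP⟩ := (hD.2.2 s(u, v)).1 huv
  rcases hD.1 P hPD with hclaw | htri
  · obtain ⟨c, rfl | rfl, hc⟩ := hclaw.exists_center hcubic hP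
    · exact (hD.not_claw_at_vertex_of_triangle hcubic huv huw hvw hunique_vw hPD hc).elim
    · exact (hD.not_claw_at_vertex_of_triangle hcubic huv.symm hvw huw hunique_uw hPD hc).elim
  · obtain ⟨t, hut, hvt, rfl⟩ := htri.exists_third hP
    obtain rfl := hunique_uv t hut hvt
    exact hPD
end

section
/- The complement of the cycle C_6 (a connected non-bipartite cubic graph containing triangles) admits no {K_{1,3}, K_3}-decomposition. -/
open SimpleGraph

variable {V : Type*}

lemma compl_cycleGraph_six_adj (u v : Fin 6) :
    (cycleGraph 6)ᶜ.Adj u v ↔ v = u + 2 ∨ v = u + 3 ∨ v = u + 4 := by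
  revert u v
  decide

/-- The claw centred at `c` in the complement of the 6-cycle. -/
def complClaw (c : Fin 6) : Finset (Sym2 (Fin 6)) :=
  clawEdges c (c + 2) (c + 3) (c + 4)

/-- The triangle through `c` in the complement of the 6-cycle. -/
def complTriangle (c : Fin 6) : Finset (Sym2 (Fin 6)) :=
  triEdges c (c + 2) (c + 4)

lemma eq_complClaw_of_isClawPart {P : Finset (Sym2 (Fin 6))}
    (h : IsClawPart (cycleGraph 6)ᶜ P) : ∃ c, P = complClaw c := by
  obtain ⟨c, a, b, d, hab, had, hbd, ha, hb, hd, rfl⟩ := h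
  refine ⟨c, ?_⟩
  rw [compl_cycleGraph_six_adj] at ha hb hd
  unfold complClaw
  rcases ha with rfl | rfl | rfl <;> rcases hb with rfl | rfl | rfl <;>
    rcases hd with rfl | rfl | rfl <;>
    first
    | exact absurd rfl hab
    | exact absurd rfl had
    | exact absurd rfl hbd
    | (clear hab had hbd; revert c; decide)

lemma eq_complTriangle_of_isTrianglePart {P : Finset (Sym2 (Fin 6))}
    (h : IsTrianglePart (cycleGraph 6)ᶜ P) : ∃ c, P = complTriangle c := by
  obtain ⟨u, v, w, ⟨huv, hvw, huw⟩, rfl⟩ := h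
  refine ⟨u, ?_⟩
  rw [compl_cycleGraph_six_adj] at huv huw
  unfold complTriangle
  rcases huv with rfl | rfl | rfl <;> rcases huw with rfl | rfl | rfl <;>
    revert u <;> decide

lemma center_of_opposite_mem_complClaw :
    ∀ i c : Fin 6, s(i, i + 3) ∈ complClaw c → c = i ∨ c = i + 3 := by
  decide

lemma opposite_notMem_complTriangle :
    ∀ i c : Fin 6, s(i, i + 3) ∉ complTriangle c := by
  decide

lemma center_of_mem_complClaw :
    ∀ i c : Fin 6, s(i, i + 2) ∈ complClaw c → c = i ∨ c = i + 2 := by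
  decide

lemma complTriangle_eq_of_mem :
    ∀ i c : Fin 6, s(i, i + 2) ∈ complTriangle c → complTriangle c = complTriangle i := by
  decide

lemma complTriangle_add_two : ∀ i : Fin 6, complTriangle (i + 2) = complTriangle i := by
  decide

lemma complClaw_ne_complClaw_add_two : ∀ i : Fin 6, complClaw i ≠ complClaw (i + 2) := by
  decide

lemma complClaw_ne_complTriangle : ∀ i : Fin 6, complClaw i ≠ complTriangle i := by
  decide

lemma mem_complClaw_left : ∀ i : Fin 6, s(i, i + 2) ∈ complClaw i := by
  decide

lemma mem_complClaw_right : ∀ i : Fin 6, s(i, i + 2) ∈ complClaw (i + 2) := by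
  decide

lemma mem_complTriangle : ∀ i : Fin 6, s(i, i + 2) ∈ complTriangle i := by
  decide

/-- The complement of the 6-cycle admits no {K₁,₃, K₃}-decomposition. -/
theorem stmt_7 :
    ¬ ∃ D : Finset (Finset (Sym2 (Fin 6))),
      IsDecompOn (SimpleGraph.cycleGraph 6)ᶜ
        (fun P => IsClawPart (SimpleGraph.cycleGraph 6)ᶜ P ∨
          IsTrianglePart (SimpleGraph.cycleGraph 6)ᶜ P) D := by
  rintro ⟨D, hallowed, hdisj, hcover⟩
  have hpart {P : Finset (Sym2 (Fin 6))} (hP : P ∈ D) :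
      (∃ c, P = complClaw c) ∨ ∃ c, P = complTriangle c :=
    (hallowed P hP).imp eq_complClaw_of_isClawPart eq_complTriangle_of_isTrianglePart
  have huniq {P Q : Finset (Sym2 (Fin 6))} (hP : P ∈ D) (hQ : Q ∈ D) (e : Sym2 (Fin 6))
      (heP : e ∈ P) (heQ : e ∈ Q) : P = Q := by
    by_contra hne
    exact Finset.disjoint_left.mp (hdisj hP hQ hne) heP heQ
  have hopp (i : Fin 6) : complClaw i ∈ D ∨ complClaw (i + 3) ∈ D := by
    obtain ⟨P, hP, he⟩ := (hcover s(i, i + 3)).mp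
      ((compl_cycleGraph_six_adj _ _).mpr (Or.inr (Or.inl rfl)))
    rcases hpart hP with ⟨c, rfl⟩ | ⟨c, rfl⟩
    · rcases center_of_opposite_mem_complClaw i c he with rfl | rfl
      exacts [Or.inl hP, Or.inr hP]
    · exact absurd he (opposite_notMem_complTriangle i c)
  have hside (i : Fin 6) :
      complClaw i ∈ D ∨ complClaw (i + 2) ∈ D ∨ complTriangle i ∈ D := by
    obtain ⟨P, hP, he⟩ := (hcover s(i, i + 2)).mp
      ((compl_cycleGraph_six_adj _ _).mpr (Or.inl rfl))
    rcases hpart hP with ⟨c, rfl⟩ | ⟨c, rfl⟩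
    · rcases center_of_mem_complClaw i c he with rfl | rfl
      exacts [Or.inl hP, Or.inr (Or.inl hP)]
    · exact Or.inr (Or.inr (complTriangle_eq_of_mem i c he ▸ hP))
  have hclaws (i : Fin 6) (h₁ : complClaw i ∈ D) (h₂ : complClaw (i + 2) ∈ D) : False :=
    complClaw_ne_complClaw_add_two i
      (huniq h₁ h₂ s(i, i + 2) (mem_complClaw_left i) (mem_complClaw_right i))
  -- Otherwise exactly one end of each side of the triangle is a claw centre: an odd cycle.
  have htri (i : Fin 6) : complTriangle i ∈ D := by
    by_contra h
    have hcycle : i + 2 + 2 + 2 = i := by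
      clear h
      revert i
      decide
    have h₁ := hside i
    have h₂ := hside (i + 2)
    have h₃ := hside (i + 2 + 2)
    have k₃ := hclaws (i + 2 + 2)
    simp only [complTriangle_add_two, hcycle, h, or_false] at h₁ h₂ h₃ k₃
    by_cases hi : complClaw i ∈ D
    · exact h₂.elim (hclaws i hi) fun h' => k₃ h' hi
    · exact hclaws (i + 2) (h₁.resolve_left hi) (h₃.resolve_right hi)
  have hnoclaw (i : Fin 6) : complClaw i ∉ D := fun h =>
    complClaw_ne_complTriangle i
      (huniq h (htri i) s(i, i + 2) (mem_complClaw_left i) (mem_complTriangle i))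
  exact (hopp 0).elim (hnoclaw 0) (hnoclaw (0 + 3))
end

section
/- Let G be a connected cubic graph admitting a {K_{1,3}, K_3, P_4}-decomposition D, and let e be a bridge of G. Then e is the middle edge of a P_4 part of D (in particular, e does not lie in a K_3 part or a K_{1,3} part of D, and is not an end edge of a P_4 part). -/
open SimpleGraph

variable {V : Type*}

open Finset in
/-- The number of endpoints of `e` that lie in `S`. -/
def endpointCount [DecidableEq V] (S : Finset V) (e : Sym2 V) : ℕ :=
  #{v ∈ S | v ∈ e}

lemma endpointCount_mk [DecidableEq V] (S : Finset V) {x y : V} (h : x ≠ y) :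
    endpointCount S s(x, y) = (if x ∈ S then 1 else 0) + (if y ∈ S then 1 else 0) := by
  have hfilter : S.filter (· ∈ s(x, y)) = S.filter (· = x) ∪ S.filter (· = y) := by
    ext v
    simp only [Finset.mem_filter, Finset.mem_union, Sym2.mem_iff]
    tauto
  have hdisj : Disjoint (S.filter (· = x)) (S.filter (· = y)) := by
    rw [Finset.disjoint_left]
    simp only [Finset.mem_filter]
    rintro v ⟨-, rfl⟩ ⟨-, hv⟩
    exact h hv
  rw [endpointCount, hfilter, Finset.card_union_of_disjoint hdisj, Finset.filter_eq',
    Finset.filter_eq']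
  split_ifs <;> simp

lemma sum_endpointCount_clawEdges [DecidableEq V] (S : Finset V) {c a b d : V}
    (hab : a ≠ b) (had : a ≠ d) (hbd : b ≠ d) (hca : c ≠ a) (hcb : c ≠ b) (hcd : c ≠ d) :
    ∑ e ∈ clawEdges c a b d, endpointCount S e =
      3 * (if c ∈ S then 1 else 0) + (if a ∈ S then 1 else 0) + (if b ∈ S then 1 else 0)
        + (if d ∈ S then 1 else 0) := by
  rw [clawEdges, Finset.sum_insert (by simp; grind), Finset.sum_insert (by simp; grind),
    Finset.sum_singleton, endpointCount_mk S hca, endpointCount_mk S hcb, endpointCount_mk S hcd]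
  ring

lemma sum_endpointCount_triEdges [DecidableEq V] (S : Finset V) {u v w : V}
    (huv : u ≠ v) (hvw : v ≠ w) (huw : u ≠ w) :
    ∑ e ∈ triEdges u v w, endpointCount S e =
      2 * (if u ∈ S then 1 else 0) + 2 * (if v ∈ S then 1 else 0)
        + 2 * (if w ∈ S then 1 else 0) := by
  rw [triEdges, Finset.sum_insert (by simp; grind), Finset.sum_insert (by simp; grind),
    Finset.sum_singleton, endpointCount_mk S huv, endpointCount_mk S hvw, endpointCount_mk S huw]
  ring

lemma sum_endpointCount_p4Edges [DecidableEq V] (S : Finset V) {a b c d : V}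
    (hab : a ≠ b) (hbc : b ≠ c) (hcd : c ≠ d) (hac : a ≠ c) (had : a ≠ d) (hbd : b ≠ d) :
    ∑ e ∈ p4Edges a b c d, endpointCount S e =
      (if a ∈ S then 1 else 0) + 2 * (if b ∈ S then 1 else 0) + 2 * (if c ∈ S then 1 else 0)
        + (if d ∈ S then 1 else 0) := by
  rw [p4Edges, Finset.sum_insert (by simp; grind), Finset.sum_insert (by simp; grind),
    Finset.sum_singleton, endpointCount_mk S hab, endpointCount_mk S hbc, endpointCount_mk S hcd]
  ring

/-- A part none of whose edges crosses the cut `(S, Sᶜ)` lies on one side of it. -/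
lemma three_dvd_sum_endpointCount [DecidableEq V] {G : SimpleGraph V} {S : Finset V}
    {P : Finset (Sym2 V)} (hP : IsClawPart G P ∨ IsTrianglePart G P ∨ IsP4Part G P)
    (hS : ∀ x y, s(x, y) ∈ P → (x ∈ S ↔ y ∈ S)) :
    3 ∣ ∑ e ∈ P, endpointCount S e := by
  rcases hP with ⟨c, a, b, d, hab, had, hbd, hca, hcb, hcd, rfl⟩ |
    ⟨u, v, w, ⟨huv, hvw, huw⟩, rfl⟩ | ⟨a, b, c, d, ⟨hab, hbc, hcd, hac, had, hbd⟩, rfl⟩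
  · rw [sum_endpointCount_clawEdges S hab had hbd hca.ne hcb.ne hcd.ne]
    have h1 := hS c a (by simp [clawEdges])
    have h2 := hS c b (by simp [clawEdges])
    have h3 := hS c d (by simp [clawEdges])
    simp only [← h1, ← h2, ← h3]
    split_ifs <;> simp
  · rw [sum_endpointCount_triEdges S huv.ne hvw.ne huw.ne]
    have h1 := hS u v (by simp [triEdges])
    have h2 := hS u w (by simp [triEdges])
    simp only [← h1, ← h2]
    split_ifs <;> simp
  · rw [sum_endpointCount_p4Edges S hab.ne hbc.ne hcd.ne hac had hbd]
    have h1 := hS a b (by simp [p4Edges])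
    have h2 := hS b c (by simp [p4Edges])
    have h3 := hS c d (by simp [p4Edges])
    simp only [← h3, ← h2, ← h1]
    split_ifs <;> simp

lemma exists_p4_middle_of_three_dvd [DecidableEq V] {G : SimpleGraph V} {S : Finset V}
    {P : Finset (Sym2 V)} (hP : IsClawPart G P ∨ IsTrianglePart G P ∨ IsP4Part G P)
    {u v : V} (hu : u ∈ S) (hv : v ∉ S) (huvP : s(u, v) ∈ P)
    (hS : ∀ x y, s(x, y) ∈ P → s(x, y) ≠ s(u, v) → (x ∈ S ↔ y ∈ S))
    (hdvd : 3 ∣ ∑ e ∈ P, endpointCount S e) :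
    ∃ a b c d : V, IsP4On G a b c d ∧ P = p4Edges a b c d ∧ s(u, v) = s(b, c) := by
  have hcross : ∀ x y, s(x, y) = s(u, v) → (x ∈ S ↔ y ∉ S) := by
    intro x y h
    rcases Sym2.eq_iff.mp h with ⟨rfl, rfl⟩ | ⟨rfl, rfl⟩ <;> simp [hu, hv]
  rcases hP with ⟨c, a, b, d, hab, had, hbd, hca, hcb, hcd, rfl⟩ |
    ⟨x, y, z, ⟨hxy, hyz, hxz⟩, rfl⟩ | ⟨a, b, c, d, hP4, rfl⟩
  · exfalso
    rw [sum_endpointCount_clawEdges S hab had hbd hca.ne hcb.ne hcd.ne] at hdvd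
    have h1 := hS c a (by simp [clawEdges])
    have h2 := hS c b (by simp [clawEdges])
    have h3 := hS c d (by simp [clawEdges])
    have hne1 : s(c, a) ≠ s(c, b) := by simp; grind
    have hne2 : s(c, a) ≠ s(c, d) := by simp; grind
    have hne3 : s(c, b) ≠ s(c, d) := by simp; grind
    simp only [clawEdges, Finset.mem_insert, Finset.mem_singleton] at huvP
    rcases huvP with h | h | h
    · have := hcross _ _ h.symm
      have := h2 (by rw [h]; exact hne1.symm)
      have := h3 (by rw [h]; exact hne2.symm)
      grind
    · have := hcross _ _ h.symm
      have := h1 (by rw [h]; exact hne1)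
      have := h3 (by rw [h]; exact hne3.symm)
      grind
    · have := hcross _ _ h.symm
      have := h1 (by rw [h]; exact hne2)
      have := h2 (by rw [h]; exact hne3)
      grind
  · exfalso
    have h1 := hS x y (by simp [triEdges])
    have h2 := hS y z (by simp [triEdges])
    have h3 := hS x z (by simp [triEdges])
    have hne := hxy.ne
    have hne' := hyz.ne
    have hne'' := hxz.ne
    have hne1 : s(x, y) ≠ s(y, z) := by simp; grind
    have hne2 : s(x, y) ≠ s(x, z) := by simp; grind
    have hne3 : s(y, z) ≠ s(x, z) := by simp; grind
    have c1 := hcross x y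
    have c2 := hcross y z
    have c3 := hcross x z
    simp only [triEdges, Finset.mem_insert, Finset.mem_singleton] at huvP
    rcases huvP with h | h | h <;> grind
  · refine ⟨a, b, c, d, hP4, rfl, ?_⟩
    obtain ⟨hab, hbc, hcd, hac, had, hbd⟩ := hP4
    rw [sum_endpointCount_p4Edges S hab.ne hbc.ne hcd.ne hac had hbd] at hdvd
    have h1 := hS a b (by simp [p4Edges])
    have h2 := hS b c (by simp [p4Edges])
    have h3 := hS c d (by simp [p4Edges])
    have hne := hab.ne
    have hne' := hbc.ne
    have hne'' := hcd.ne
    have hne1 : s(a, b) ≠ s(b, c) := by simp; grind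
    have hne2 : s(a, b) ≠ s(c, d) := by simp; grind
    have hne3 : s(b, c) ≠ s(c, d) := by simp; grind
    simp only [p4Edges, Finset.mem_insert, Finset.mem_singleton] at huvP
    rcases huvP with h | h | h
    · have := hcross _ _ h.symm
      have := h2 (by rw [h]; exact hne1.symm)
      have := h3 (by rw [h]; exact hne2.symm)
      grind
    · exact h
    · have := hcross _ _ h.symm
      have := h1 (by rw [h]; exact hne2)
      have := h2 (by rw [h]; exact hne3)
      grind

/-- The degree sum over `S`, with each edge counted once per endpoint in `S`. -/
lemma sum_endpointCount_edgeFinset [Fintype V] [DecidableEq V] (G : SimpleGraph V)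
    [DecidableRel G.Adj] (S : Finset V) :
    ∑ e ∈ G.edgeFinset, endpointCount S e = ∑ v ∈ S, G.degree v := by
  simp only [← card_incidenceFinset_eq_degree, incidenceFinset_eq_filter]
  exact (Finset.sum_card_bipartiteAbove_eq_sum_card_bipartiteBelow (fun v e => v ∈ e)).symm

/-- In any {K₁,₃, K₃, P₄}-decomposition of a connected cubic graph, every bridge
is the middle edge of a P₄ part. -/
theorem stmt_10 [Fintype V] [DecidableEq V] (G : SimpleGraph V)
    (hconn : G.Connected) (hcubic : ∀ v : V, (G.neighborSet v).ncard = 3)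
    (D : Finset (Finset (Sym2 V)))
    (hD : IsDecompOn G
      (fun P => IsClawPart G P ∨ IsTrianglePart G P ∨ IsP4Part G P) D)
    (e : Sym2 V) (he : G.IsBridge e) :
    ∃ P ∈ D, ∃ a b c d : V, IsP4On G a b c d ∧ P = p4Edges a b c d ∧
      e = s(b, c) := by
  classical
  obtain ⟨hparts, hdisj, hcover⟩ := hD
  induction e with
  | h u v =>
  have huv : G.Adj u v := he.reachable_iff_adj.mp (hconn.preconnected u v)
  rw [isBridge_iff] at he
  set S : Finset V := {x | (G.deleteEdges {s(u, v)}).Reachable u x} with hSdef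
  have hcut : ∀ x y, G.Adj x y → s(x, y) ≠ s(u, v) → (x ∈ S ↔ y ∈ S) := by
    intro x y hxy hne
    have hadj : (G.deleteEdges {s(u, v)}).Adj x y := by simp [deleteEdges_adj, hxy, hne]
    simp only [hSdef, Finset.mem_filter, Finset.mem_univ, true_and]
    exact ⟨fun h => h.trans hadj.reachable, fun h => h.trans hadj.symm.reachable⟩
  have hadj : ∀ P ∈ D, ∀ x y, s(x, y) ∈ P → G.Adj x y := fun P hP x y h =>
    (hcover s(x, y)).mpr ⟨P, hP, h⟩
  obtain ⟨P, hPD, huvP⟩ := (hcover s(u, v)).mp huv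
  have hedges : G.edgeFinset = D.biUnion id := by
    ext e
    simp [hcover e]
  have htotal : 3 ∣ ∑ Q ∈ D, ∑ e ∈ Q, endpointCount S e := by
    have hsum : ∑ e ∈ D.biUnion id, endpointCount S e = ∑ Q ∈ D, ∑ e ∈ Q, endpointCount S e :=
      Finset.sum_biUnion hdisj
    rw [← hsum, ← hedges, sum_endpointCount_edgeFinset]
    refine Finset.dvd_sum fun v _ => ?_
    rw [← card_neighborSet_eq_degree, ← Nat.card_eq_fintype_card, Nat.card_coe_set_eq, hcubic v]
  have hothers : 3 ∣ ∑ Q ∈ D.erase P, ∑ e ∈ Q, endpointCount S e := by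
    refine Finset.dvd_sum fun Q hQ => ?_
    obtain ⟨hQP, hQD⟩ := Finset.mem_erase.mp hQ
    refine three_dvd_sum_endpointCount (hparts Q hQD) fun x y hxy =>
      hcut x y (hadj Q hQD x y hxy) fun heq => ?_
    exact Finset.disjoint_left.mp (hdisj hQD hPD hQP) (heq ▸ hxy) huvP
  have hdvd : 3 ∣ ∑ e ∈ P, endpointCount S e := by
    rw [← Finset.add_sum_erase D _ hPD] at htotal
    exact (Nat.dvd_add_left hothers).mp htotal
  exact ⟨P, hPD, exists_p4_middle_of_three_dvd (hparts P hPD) (by simp [hSdef])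
    (by simpa [hSdef] using he) huvP (fun x y hxy => hcut x y (hadj P hPD x y hxy)) hdvd⟩
end

section
/- Let G be a cubic graph containing an induced diamond on vertices {u, v, w, x} with {u, x} not an edge (so the diamond's edges are uv, uw, vw, vx, wx), and let u' and x' be the third neighbours of u and x respectively (outside the diamond). Then in any {K_{1,3}, K_3}-decomposition D of G, exactly one of the following holds: (i) {u, v, w} forms a K_3 part of D and the edges vx, wx, xx' form a K_{1,3} part of D centered at x; or (ii) {v, w, x} forms a K_3 part of D and the edges uv, uw, uu' form a K_{1,3} part of D centered at u. -/
open SimpleGraph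

variable {V : Type*}

lemma triEdges_rotate [DecidableEq V] (u v w : V) : triEdges u v w = triEdges v w u := by
  ext e
  simp only [triEdges, Finset.mem_insert, Finset.mem_singleton, Sym2.eq_swap (a := w) (b := u),
    Sym2.eq_swap (a := v) (b := u)]
  tauto

lemma triEdges_swap [DecidableEq V] (u v w : V) : triEdges u v w = triEdges v u w := by
  ext e
  simp only [triEdges, Finset.mem_insert, Finset.mem_singleton, Sym2.eq_swap (a := v) (b := u)]
  tauto

/-- If a vertex has exactly three neighbours, the edges at it are those of the claw on any three
distinct neighbours. -/
lemma coe_clawEdges_eq_incidenceSet [DecidableEq V] {G : SimpleGraph V} {c a b d : V}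
    (hc : (G.neighborSet c).ncard = 3) (hab : a ≠ b) (had : a ≠ d) (hbd : b ≠ d)
    (ha : G.Adj c a) (hb : G.Adj c b) (hd : G.Adj c d) :
    (clawEdges c a b d : Set (Sym2 V)) = G.incidenceSet c := by
  have hfin : (G.neighborSet c).Finite := Set.finite_of_ncard_ne_zero (by omega)
  have hsub : ({a, b, d} : Set V) ⊆ G.neighborSet c := by
    rintro y (rfl | rfl | rfl) <;> assumption
  have hN : ({a, b, d} : Set V) = G.neighborSet c :=
    Set.eq_of_subset_of_ncard_le hsub
      (by rw [hc, Set.ncard_eq_three.mpr ⟨a, b, d, hab, had, hbd, rfl⟩]) hfin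
  have himage : (fun y => s(c, y)) '' G.neighborSet c = G.incidenceSet c := by
    ext e
    constructor
    · rintro ⟨y, hy, rfl⟩
      exact ⟨hy, Sym2.mem_mk_left c y⟩
    · rintro ⟨he, y, rfl⟩
      exact ⟨y, he, rfl⟩
  rw [← himage, ← hN]
  simp [clawEdges, Set.image_insert_eq]

/-- The neighbours of a vertex of degree three are any three distinct ones. -/
lemma eq_or_eq_or_eq_of_adj [DecidableEq V] {G : SimpleGraph V} {c a b d y : V}
    (hc : (G.neighborSet c).ncard = 3) (hab : a ≠ b) (had : a ≠ d) (hbd : b ≠ d)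
    (ha : G.Adj c a) (hb : G.Adj c b) (hd : G.Adj c d) (hy : G.Adj c y) :
    y = a ∨ y = b ∨ y = d := by
  have h : s(c, y) ∈ (clawEdges c a b d : Set (Sym2 V)) := by
    rw [coe_clawEdges_eq_incidenceSet hc hab had hbd ha hb hd]
    exact ⟨hy, Sym2.mem_mk_left c y⟩
  simpa [clawEdges, ha.ne, hb.ne, hd.ne] using h

lemma mem_of_coe_eq_incidenceSet {G : SimpleGraph V} {P : Finset (Sym2 V)} {c y : V}
    (hP : (P : Set (Sym2 V)) = G.incidenceSet c) (hy : G.Adj c y) : s(c, y) ∈ P := by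
  rw [← Finset.mem_coe, hP]
  exact ⟨hy, Sym2.mem_mk_left c y⟩

lemma IsDecompOn.eq_of_mem [DecidableEq V] {G : SimpleGraph V}
    {allowed : Finset (Sym2 V) → Prop} {D : Finset (Finset (Sym2 V))}
    (hD : IsDecompOn G allowed D) {P Q : Finset (Sym2 V)} {e : Sym2 V}
    (hP : P ∈ D) (hQ : Q ∈ D) (heP : e ∈ P) (heQ : e ∈ Q) : P = Q := by
  by_contra hne
  exact Finset.disjoint_left.mp (hD.2.1 hP hQ hne) heP heQ

/-- In a decomposition of a cubic graph into claws and triangles, the part of an edge is the full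
star at one of its ends or a triangle on it. -/
lemma IsDecompOn.exists_part [DecidableEq V] {G : SimpleGraph V}
    (hcubic : ∀ y : V, (G.neighborSet y).ncard = 3) {D : Finset (Finset (Sym2 V))}
    (hD : IsDecompOn G (fun P => IsClawPart G P ∨ IsTrianglePart G P) D)
    {a b : V} (hab : G.Adj a b) :
    ∃ P ∈ D, s(a, b) ∈ P ∧ ((P : Set (Sym2 V)) = G.incidenceSet a ∨
      (P : Set (Sym2 V)) = G.incidenceSet b ∨
      ∃ c, G.Adj a c ∧ G.Adj b c ∧ P = triEdges a b c) := by
  obtain ⟨P, hP, he⟩ := (hD.2.2 s(a, b)).mp hab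
  refine ⟨P, hP, he, ?_⟩
  rcases hD.1 P hP with ⟨c, p, q, r, hpq, hpr, hqr, hp, hq, hr, rfl⟩ |
    ⟨p, q, r, ⟨hpq, hqr, hpr⟩, rfl⟩
  · have hstar := coe_clawEdges_eq_incidenceSet (hcubic c) hpq hpr hqr hp hq hr
    have hmem : s(a, b) ∈ G.incidenceSet c := hstar ▸ Finset.mem_coe.mpr he
    rcases Sym2.mem_iff.mp hmem.2 with rfl | rfl
    · exact .inl hstar
    · exact .inr (.inl hstar)
  · refine .inr (.inr ?_)
    simp only [triEdges, Finset.mem_insert, Finset.mem_singleton, Sym2.eq_iff] at he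
    rcases he with (⟨rfl, rfl⟩ | ⟨rfl, rfl⟩) | (⟨rfl, rfl⟩ | ⟨rfl, rfl⟩) |
      (⟨rfl, rfl⟩ | ⟨rfl, rfl⟩)
    · exact ⟨r, hpr, hqr, rfl⟩
    · exact ⟨r, hqr, hpr, triEdges_swap ..⟩
    · exact ⟨p, hpq.symm, hpr.symm, triEdges_rotate ..⟩
    · exact ⟨p, hpr.symm, hpq.symm, (triEdges_rotate ..).trans (triEdges_swap ..)⟩
    · exact ⟨q, hpq, hqr.symm, (triEdges_swap ..).trans (triEdges_rotate ..)⟩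
    · exact ⟨q, hqr.symm, hpq, (triEdges_rotate ..).symm⟩

/-- The central edge `vw` of a diamond does not lie in the claw centred at `v`: the edge `uw` would
then have no part. -/
lemma IsDecompOn.star_notMem_of_diamond [DecidableEq V] {G : SimpleGraph V}
    (hcubic : ∀ y : V, (G.neighborSet y).ncard = 3) {D : Finset (Finset (Sym2 V))}
    (hD : IsDecompOn G (fun P => IsClawPart G P ∨ IsTrianglePart G P) D)
    {u v w x : V} (hux : u ≠ x) (hnadj : ¬ G.Adj u x)
    (huv : G.Adj u v) (huw : G.Adj u w) (hvw : G.Adj v w) (hvx : G.Adj v x) (hwx : G.Adj w x)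
    {P : Finset (Sym2 V)} (hP : P ∈ D) : (P : Set (Sym2 V)) ≠ G.incidenceSet v := by
  intro hstar
  have hvwP := mem_of_coe_eq_incidenceSet hstar hvw
  have hvuP := mem_of_coe_eq_incidenceSet hstar huv.symm
  obtain ⟨Q, hQ, he, hcases⟩ := hD.exists_part hcubic huw
  have hQP : Q = P := by
    rcases hcases with h | h | ⟨c, huc, hwc, rfl⟩
    · exact hD.eq_of_mem hQ hP (Sym2.eq_swap ▸ mem_of_coe_eq_incidenceSet h huv) hvuP
    · exact hD.eq_of_mem hQ hP (Sym2.eq_swap ▸ mem_of_coe_eq_incidenceSet h hvw.symm) hvwP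
    · rcases eq_or_eq_or_eq_of_adj (hcubic w) huv.ne hux hvx.ne huw.symm hvw.symm hwx hwc with
        rfl | rfl | rfl
      · exact absurd huc G.irrefl
      · exact hD.eq_of_mem hQ hP (e := s(c, w)) (by simp [triEdges, Sym2.eq_swap]) hvwP
      · exact absurd huc hnadj
  subst hQP
  have hmem : s(u, w) ∈ G.incidenceSet v := hstar ▸ Finset.mem_coe.mpr he
  rcases Sym2.mem_iff.mp hmem.2 with rfl | rfl
  · exact huv.ne rfl
  · exact hvw.ne rfl

/-- If one triangle of a diamond is a part, then the edges at the opposite vertex form a part. -/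
lemma IsDecompOn.clawEdges_mem_of_triEdges_mem [DecidableEq V] {G : SimpleGraph V}
    (hcubic : ∀ y : V, (G.neighborSet y).ncard = 3) {D : Finset (Finset (Sym2 V))}
    (hD : IsDecompOn G (fun P => IsClawPart G P ∨ IsTrianglePart G P) D)
    {u v w x x' : V} (hux : u ≠ x) (hnadj : ¬ G.Adj u x)
    (huv : G.Adj u v) (hvw : G.Adj v w) (hvx : G.Adj v x) (hwx : G.Adj w x)
    (huw : G.Adj u w) (hx' : G.Adj x x') (hx'v : x' ≠ v) (hx'w : x' ≠ w)
    (hT : triEdges u v w ∈ D) : clawEdges x v w x' ∈ D := by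
  have hvwT : s(v, w) ∈ triEdges u v w := by simp [triEdges]
  have hvxT : s(v, x) ∉ triEdges u v w := by
    simp [triEdges, huv.ne', hvw.ne, hwx.ne', hux.symm]
  obtain ⟨Q, hQ, he, h | h | ⟨c, hvc, hxc, rfl⟩⟩ := hD.exists_part hcubic hvx
  · exact absurd (hD.eq_of_mem hQ hT (mem_of_coe_eq_incidenceSet h hvw) hvwT ▸ he) hvxT
  · rw [← coe_clawEdges_eq_incidenceSet (hcubic x) hvw.ne hx'v.symm hx'w.symm hvx.symm hwx.symm hx',
      Finset.coe_inj] at h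
    exact h ▸ hQ
  · rcases eq_or_eq_or_eq_of_adj (hcubic v) huw.ne hux hwx.ne huv.symm hvw hvx hvc with
      rfl | rfl | rfl
    · exact absurd hxc.symm hnadj
    · exact absurd (hD.eq_of_mem hQ hT (e := s(v, c)) (by simp [triEdges]) hvwT ▸ he) hvxT
    · exact absurd hxc G.irrefl

/-- Given an induced diamond on `{u,v,w,x}` (non-edge `{u,x}`) in a cubic graph,
with `u'`, `x'` the third neighbours of `u`, `x`, any {K₁,₃, K₃}-decomposition
uses its edges in exactly one of two ways: the triangle `uvw` together with the
claw centered at `x` on `v, w, x'`, or the triangle `vwx` together with the claw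
centered at `u` on `v, w, u'`. -/
theorem stmt_12 [Fintype V] [DecidableEq V] (G : SimpleGraph V)
    (hcubic : ∀ y : V, (G.neighborSet y).ncard = 3)
    (u v w x u' x' : V)
    (hux : u ≠ x) (hnadj : ¬ G.Adj u x)
    (huv : G.Adj u v) (huw : G.Adj u w) (hvw : G.Adj v w)
    (hvx : G.Adj v x) (hwx : G.Adj w x)
    (hu' : G.Adj u u') (hu'v : u' ≠ v) (hu'w : u' ≠ w)
    (hx' : G.Adj x x') (hx'v : x' ≠ v) (hx'w : x' ≠ w)
    (D : Finset (Finset (Sym2 V)))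
    (hD : IsDecompOn G (fun P => IsClawPart G P ∨ IsTrianglePart G P) D) :
    Xor' (triEdges u v w ∈ D ∧ clawEdges x v w x' ∈ D)
         (triEdges v w x ∈ D ∧ clawEdges u v w u' ∈ D) := by
  have hright : triEdges u v w ∈ D → clawEdges x v w x' ∈ D :=
    hD.clawEdges_mem_of_triEdges_mem hcubic hux hnadj huv hvw hvx hwx huw hx' hx'v hx'w
  have hleft : triEdges v w x ∈ D → clawEdges u v w u' ∈ D := by
    rw [← triEdges_rotate x v w]
    exact hD.clawEdges_mem_of_triEdges_mem hcubic hux.symm (fun h => hnadj h.symm)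
      hvx.symm hvw huv.symm huw.symm hwx.symm hu' hu'v hu'w
  have hone : triEdges u v w ∈ D ∨ triEdges v w x ∈ D := by
    obtain ⟨P, hP, -, h | h | ⟨c, hvc, hwc, rfl⟩⟩ := hD.exists_part hcubic hvw
    · exact absurd h (hD.star_notMem_of_diamond hcubic hux hnadj huv huw hvw hvx hwx hP)
    · exact absurd h (hD.star_notMem_of_diamond hcubic hux hnadj huw huv hvw.symm hwx hvx hP)
    · rcases eq_or_eq_or_eq_of_adj (hcubic v) huw.ne hux hwx.ne huv.symm hvw hvx hvc with
        rfl | rfl | rfl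
      · exact .inl (triEdges_rotate c v w ▸ hP)
      · exact absurd hwc G.irrefl
      · exact .inr hP
  have hnot : ¬ (triEdges u v w ∈ D ∧ triEdges v w x ∈ D) := by
    rintro ⟨h₁, h₂⟩
    have heq := hD.eq_of_mem h₁ h₂ (e := s(v, w)) (by simp [triEdges]) (by simp [triEdges])
    have hmem : s(v, x) ∈ triEdges u v w := heq ▸ by simp [triEdges]
    simp [triEdges, huv.ne', hvw.ne, hwx.ne', hux.symm] at hmem
  unfold Xor'
  tauto
end

section
/- Let G be a cubic graph on at least 6 vertices containing an induced diamond on vertices {u, v, w, x} with {u, x} not an edge, and let u' and x' be the third neighbours of u and x respectively (outside the diamond). If u' = x', then G admits no {K_{1,3}, K_3}-decomposition. -/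
open SimpleGraph

variable {V : Type*}

theorem adj_eq_of_ncard_eq_three {G : SimpleGraph V} {c a b d z : V}
    (hc : (G.neighborSet c).ncard = 3) (hab : a ≠ b) (had : a ≠ d) (hbd : b ≠ d)
    (ha : G.Adj c a) (hb : G.Adj c b) (hd : G.Adj c d) (hz : G.Adj c z) :
    z = a ∨ z = b ∨ z = d := by
  have hfin : (G.neighborSet c).Finite := Set.finite_of_ncard_ne_zero (by omega)
  have hsub : ({a, b, d} : Set V) ⊆ G.neighborSet c := by
    rintro t (rfl | rfl | rfl) <;> assumption
  have hcard : ({a, b, d} : Set V).ncard = 3 :=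
    Set.ncard_eq_three.mpr ⟨a, b, d, hab, had, hbd, rfl⟩
  have heq := Set.eq_of_subset_of_ncard_le hsub (by omega) hfin
  have hmem : z ∈ ({a, b, d} : Set V) := heq ▸ hz
  simpa using hmem

/-- `c` is the centre of a part of `D` which consists of edges at `c` and contains all of them. -/
def IsCenter (G : SimpleGraph V) (D : Finset (Finset (Sym2 V))) (c : V) : Prop :=
  ∃ P ∈ D, (∀ b, G.Adj c b → s(c, b) ∈ P) ∧ ∀ e ∈ P, c ∈ e

theorem part_eq_of_mem {D : Finset (Finset (Sym2 V))}
    (hD : (D : Set (Finset (Sym2 V))).PairwiseDisjoint id) {P Q : Finset (Sym2 V)}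
    (hP : P ∈ D) (hQ : Q ∈ D) {e : Sym2 V} (heP : e ∈ P) (heQ : e ∈ Q) : P = Q :=
  hD.elim_finset hP hQ e heP heQ

theorem IsDecompOn.isCenter_or_triangle [DecidableEq V] {G : SimpleGraph V}
    (hcubic : ∀ z : V, (G.neighborSet z).ncard = 3) {D : Finset (Finset (Sym2 V))}
    (hD : IsDecompOn G (fun P => IsClawPart G P ∨ IsTrianglePart G P) D)
    {a b : V} (hab : G.Adj a b) :
    IsCenter G D a ∨ IsCenter G D b ∨
      ∃ t, G.Adj a t ∧ G.Adj b t ∧ triEdges a b t ∈ D := by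
  obtain ⟨P, hP, heP⟩ := (hD.2.2 s(a, b)).mp hab
  rcases hD.1 P hP with ⟨c, p, q, r, hpq, hpr, hqr, hp, hq, hr, rfl⟩ |
      ⟨p, q, r, ⟨hpq, hqr, hpr⟩, rfl⟩
  · have hc : IsCenter G D c := by
      refine ⟨_, hP, fun z hz => ?_, fun e he => ?_⟩
      · rcases adj_eq_of_ncard_eq_three (hcubic c) hpq hpr hqr hp hq hr hz with
          rfl | rfl | rfl <;> simp [clawEdges]
      · simp only [clawEdges, Finset.mem_insert, Finset.mem_singleton] at he
        rcases he with rfl | rfl | rfl <;> simp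
    have hmem : a = c ∨ b = c := by
      simp only [clawEdges, Finset.mem_insert, Finset.mem_singleton, Sym2.eq_iff] at heP
      tauto
    rcases hmem with rfl | rfl
    · exact Or.inl hc
    · exact Or.inr (Or.inl hc)
  · right; right
    have key : ∀ t, triEdges a b t = triEdges p q r → triEdges a b t ∈ D := fun t h => h ▸ hP
    simp only [triEdges, Finset.mem_insert, Finset.mem_singleton, Sym2.eq_iff] at heP
    rcases heP with (⟨rfl, rfl⟩ | ⟨rfl, rfl⟩) | (⟨rfl, rfl⟩ | ⟨rfl, rfl⟩) |
      (⟨rfl, rfl⟩ | ⟨rfl, rfl⟩)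
    · exact ⟨r, hpr, hqr, key _ rfl⟩
    · exact ⟨r, hqr, hpr, key _ (by ext e; simp [triEdges, Sym2.eq_swap]; tauto)⟩
    · exact ⟨p, hpq.symm, hpr.symm, key _ (by ext e; simp [triEdges, Sym2.eq_swap]; tauto)⟩
    · exact ⟨p, hpr.symm, hpq.symm, key _ (by ext e; simp [triEdges, Sym2.eq_swap]; tauto)⟩
    · exact ⟨q, hpq, hqr.symm, key _ (by ext e; simp [triEdges, Sym2.eq_swap]; tauto)⟩
    · exact ⟨q, hqr.symm, hpq, key _ (by ext e; simp [triEdges, Sym2.eq_swap]; tauto)⟩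

theorem IsCenter.not_isCenter_of_adj {G : SimpleGraph V} {D : Finset (Finset (Sym2 V))}
    (hD : (D : Set (Finset (Sym2 V))).PairwiseDisjoint id) {a b d : V}
    (ha : IsCenter G D a) (hab : G.Adj a b) (had : G.Adj a d) (hbd : b ≠ d) :
    ¬ IsCenter G D b := by
  rintro ⟨Q, hQ, hQall, hQmem⟩
  obtain ⟨P, hP, hPall, -⟩ := ha
  obtain rfl := part_eq_of_mem hD hP hQ (hPall b hab) (Sym2.eq_swap ▸ hQall a hab.symm)
  have hb := hQmem _ (hPall d had)
  rcases Sym2.mem_iff.mp hb with h | h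
  · exact hab.ne h.symm
  · exact hbd h

theorem IsCenter.triEdges_notMem [DecidableEq V] {G : SimpleGraph V}
    {D : Finset (Finset (Sym2 V))}
    (hD : (D : Set (Finset (Sym2 V))).PairwiseDisjoint id) {a b t c : V}
    (hab : G.Adj a b) (hat : G.Adj a t) (hbt : G.Adj b t)
    (hc : IsCenter G D c) (hmem : c = a ∨ c = b ∨ c = t) : triEdges a b t ∉ D := by
  intro hT
  obtain ⟨P, hP, hPall, hPmem⟩ := hc
  have hPT : P = triEdges a b t := by
    rcases hmem with rfl | rfl | rfl
    · exact part_eq_of_mem hD hP hT (hPall b hab) (by simp [triEdges])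
    · exact part_eq_of_mem hD hP hT (hPall t hbt) (by simp [triEdges])
    · exact part_eq_of_mem hD hP hT (hPall b hbt.symm) (by simp [triEdges])
  subst hPT
  have h1 := hPmem s(a, b) (by simp [triEdges])
  have h2 := hPmem s(b, t) (by simp [triEdges])
  have h3 := hPmem s(a, t) (by simp [triEdges])
  have := hab.ne
  have := hat.ne
  have := hbt.ne
  simp only [Sym2.mem_iff] at h1 h2 h3
  grind

/-- If a cubic graph on at least 6 vertices contains an induced diamond on
`{u,v,w,x}` (non-edge `{u,x}`) whose two outside neighbours coincide
(`u' = x' = y`), then it admits no {K₁,₃, K₃}-decomposition. -/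
theorem stmt_13 [Fintype V] [DecidableEq V] (G : SimpleGraph V)
    (hcard : 6 ≤ Fintype.card V)
    (hcubic : ∀ z : V, (G.neighborSet z).ncard = 3)
    (u v w x y : V)
    (hux : u ≠ x) (hnadj : ¬ G.Adj u x)
    (huv : G.Adj u v) (huw : G.Adj u w) (hvw : G.Adj v w)
    (hvx : G.Adj v x) (hwx : G.Adj w x)
    (hyu : G.Adj u y) (hyx : G.Adj x y) (hyv : y ≠ v) (hyw : y ≠ w) :
    ¬ ∃ D : Finset (Finset (Sym2 V)),
      IsDecompOn G (fun P => IsClawPart G P ∨ IsTrianglePart G P) D := by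
  rintro ⟨D, hD⟩
  have hv : ∀ {z}, G.Adj v z → z = u ∨ z = w ∨ z = x :=
    adj_eq_of_ncard_eq_three (hcubic v) huw.ne hux hwx.ne huv.symm hvw hvx
  have hw : ∀ {z}, G.Adj w z → z = u ∨ z = v ∨ z = x :=
    adj_eq_of_ncard_eq_three (hcubic w) huv.ne hux hvx.ne huw.symm hvw.symm hwx
  have hu : ∀ {z}, G.Adj u z → z = v ∨ z = w ∨ z = y :=
    adj_eq_of_ncard_eq_three (hcubic u) hvw.ne hyv.symm hyw.symm huv huw hyu
  have hx : ∀ {z}, G.Adj x z → z = v ∨ z = w ∨ z = y :=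
    adj_eq_of_ncard_eq_three (hcubic x) hvw.ne hyv.symm hyw.symm hvx.symm hwx.symm hyx
  have hvy : ¬ G.Adj v y := fun h => by
    rcases hv h with h | h | h
    exacts [hyu.ne h.symm, hyw h, hyx.ne h.symm]
  have hwy : ¬ G.Adj w y := fun h => by
    rcases hw h with h | h | h
    exacts [hyu.ne h.symm, hyv h, hyx.ne h.symm]
  have huyC : IsCenter G D u ∨ IsCenter G D y := by
    rcases hD.isCenter_or_triangle hcubic hyu with h | h | ⟨t, h1, h2, -⟩
    · exact Or.inl h
    · exact Or.inr h
    · rcases hu h1 with rfl | rfl | rfl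
      exacts [(hvy h2.symm).elim, (hwy h2.symm).elim, (h2.ne rfl).elim]
  have hdisj := hD.2.1
  by_cases hvC : IsCenter G D v
  · have huC : ¬ IsCenter G D u := hvC.not_isCenter_of_adj hdisj huv.symm hvw huw.ne
    have hwC : ¬ IsCenter G D w := hvC.not_isCenter_of_adj hdisj hvw huv.symm huw.ne'
    rcases hD.isCenter_or_triangle hcubic huw with h | h | ⟨t, h1, h2, hT⟩
    · exact huC h
    · exact hwC h
    · rcases hu h1 with rfl | rfl | rfl
      exacts [hvC.triEdges_notMem hdisj huw h1 h2 (by simp) hT, h2.ne rfl, hwy h2]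
  by_cases hwC : IsCenter G D w
  · have huC : ¬ IsCenter G D u := hwC.not_isCenter_of_adj hdisj huw.symm hvw.symm huv.ne
    rcases hD.isCenter_or_triangle hcubic huv with h | h | ⟨t, h1, h2, hT⟩
    · exact huC h
    · exact hvC h
    · rcases hu h1 with rfl | rfl | rfl
      exacts [h2.ne rfl, hwC.triEdges_notMem hdisj huv h1 h2 (by simp) hT, hvy h2]
  have hxyC : IsCenter G D x ∨ IsCenter G D y := by
    rcases hD.isCenter_or_triangle hcubic hyx with h | h | ⟨t, h1, h2, -⟩
    · exact Or.inl h
    · exact Or.inr h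
    · rcases hx h1 with rfl | rfl | rfl
      exacts [(hvy h2.symm).elim, (hwy h2.symm).elim, (h2.ne rfl).elim]
  by_cases hyC : IsCenter G D y
  · have huC : ¬ IsCenter G D u := hyC.not_isCenter_of_adj hdisj hyu.symm hyx.symm hux
    have hxC : ¬ IsCenter G D x := hyC.not_isCenter_of_adj hdisj hyx.symm hyu.symm hux.symm
    have hT1 : triEdges u v w ∈ D := by
      rcases hD.isCenter_or_triangle hcubic huv with h | h | ⟨t, h1, h2, hT⟩
      · exact (huC h).elim
      · exact (hvC h).elim
      · rcases hu h1 with rfl | rfl | rfl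
        exacts [(h2.ne rfl).elim, hT, (hvy h2).elim]
    have hT2 : triEdges x v w ∈ D := by
      rcases hD.isCenter_or_triangle hcubic hvx.symm with h | h | ⟨t, h1, h2, hT⟩
      · exact (hxC h).elim
      · exact (hvC h).elim
      · rcases hx h1 with rfl | rfl | rfl
        exacts [(h2.ne rfl).elim, hT, (hvy h2).elim]
    have heq := part_eq_of_mem hdisj hT1 hT2 (e := s(v, w)) (by simp [triEdges])
      (by simp [triEdges])
    have hmem : s(u, v) ∈ triEdges x v w := heq ▸ by simp [triEdges]
    have := huv.ne
    have := huw.ne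
    simp only [triEdges, Finset.mem_insert, Finset.mem_singleton, Sym2.eq_iff] at hmem
    tauto
  · have huC := huyC.resolve_right hyC
    have hxC := hxyC.resolve_right hyC
    rcases hD.isCenter_or_triangle hcubic hvw with h | h | ⟨t, h1, h2, hT⟩
    · exact hvC h
    · exact hwC h
    · rcases hv h1 with rfl | rfl | rfl
      exacts [huC.triEdges_notMem hdisj hvw h1 h2 (by simp) hT, h2.ne rfl,
        hxC.triEdges_notMem hdisj hvw h1 h2 (by simp) hT]
end

section
/- Let G be a graph in which every vertex has degree 2 or 3, let M be a set of edges of G, and let t_1, t_2, t_3 be three distinct degree-2 vertices of G. Let G' be obtained from G by adding three new vertices v_1, v_2, v_3, the triangle edges v_1v_2, v_2v_3, v_1v_3, and the edges t_1v_1, t_2v_2, t_3v_3, and let M' = M ∪ {t_1v_1, t_2v_2, t_3v_3}. Then every vertex of G' has degree 2 or 3, G' has exactly three fewer degree-2 vertices than G, and (G, M) admits a marked {K_{1,3}, K_3, P_4}-decomposition if and only if (G', M') does. -/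
open SimpleGraph

variable {V : Type*}

/-- A marked {K₁,₃, K₃, P₄}-decomposition of `(G, M)`: a partition of the edge
set into claws, triangles containing one or two marked edges, and paths P₄
whose middle edge is unmarked. -/
def IsMarkedDecompOn [DecidableEq V] (G : SimpleGraph V) (M : Set (Sym2 V))
    (D : Finset (Finset (Sym2 V))) : Prop :=
  IsDecompOn G (fun P =>
    IsClawPart G P ∨
    (IsTrianglePart G P ∧
      (((P : Set (Sym2 V)) ∩ M).ncard = 1 ∨ ((P : Set (Sym2 V)) ∩ M).ncard = 2)) ∨
    (∃ a b c d : V, IsP4On G a b c d ∧ P = p4Edges a b c d ∧ s(b, c) ∉ M)) D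

/-- The graph obtained from `G` by adding a net over the degree-2 vertices
`t₁, t₂, t₃`: new vertices `v₁, v₂, v₃` (the three elements of `Fin 3`) forming
a triangle, with `tᵢ` joined to `vᵢ`. -/
def netAdd (G : SimpleGraph V) (t₁ t₂ t₃ : V) : SimpleGraph (V ⊕ Fin 3) :=
  SimpleGraph.fromEdgeSet
    (Sym2.map Sum.inl '' G.edgeSet ∪
      {s(Sum.inl t₁, Sum.inr 0), s(Sum.inl t₂, Sum.inr 1), s(Sum.inl t₃, Sum.inr 2),
       s(Sum.inr 0, Sum.inr 1), s(Sum.inr 1, Sum.inr 2), s(Sum.inr 0, Sum.inr 2)})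

/-- The condition on the parts of a marked decomposition. -/
def IsMarkedPart [DecidableEq V] (G : SimpleGraph V) (M : Set (Sym2 V))
    (P : Finset (Sym2 V)) : Prop :=
  IsClawPart G P ∨
    (IsTrianglePart G P ∧
      (((P : Set (Sym2 V)) ∩ M).ncard = 1 ∨ ((P : Set (Sym2 V)) ∩ M).ncard = 2)) ∨
    (∃ a b c d : V, IsP4On G a b c d ∧ P = p4Edges a b c d ∧ s(b, c) ∉ M)

theorem IsMarkedPart.card_eq_three [DecidableEq V] {G : SimpleGraph V} {M : Set (Sym2 V)}
    {P : Finset (Sym2 V)} (h : IsMarkedPart G M P) : P.card = 3 := by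
  rw [Finset.card_eq_three]
  rcases h with ⟨c, a, b, d, hab, had, hbd, hca, hcb, hcd, rfl⟩ |
    ⟨⟨u, v, w, ⟨huv, hvw, huw⟩, rfl⟩, -⟩ | ⟨a, b, c, d, ⟨hab, hbc, hcd, hac, had, hbd⟩, rfl, -⟩
  · refine ⟨_, _, _, ?_, ?_, ?_, rfl⟩ <;> grind [Sym2.eq_iff]
  · have := huv.ne
    have := hvw.ne
    have := huw.ne
    refine ⟨_, _, _, ?_, ?_, ?_, rfl⟩ <;> grind [Sym2.eq_iff]
  · have := hab.ne
    have := hbc.ne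
    have := hcd.ne
    refine ⟨_, _, _, ?_, ?_, ?_, rfl⟩ <;> grind [Sym2.eq_iff]

section Transfer

variable {W : Type*} [DecidableEq V] [DecidableEq W] {f : V ↪ W}

theorem map_clawEdges (c a b d : V) :
    (clawEdges c a b d).map f.sym2Map = clawEdges (f c) (f a) (f b) (f d) := by
  simp [clawEdges, Finset.map_insert]

theorem map_triEdges (u v w : V) :
    (triEdges u v w).map f.sym2Map = triEdges (f u) (f v) (f w) := by
  simp [triEdges, Finset.map_insert]

theorem map_p4Edges (a b c d : V) :
    (p4Edges a b c d).map f.sym2Map = p4Edges (f a) (f b) (f c) (f d) := by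
  simp [p4Edges, Finset.map_insert]

omit [DecidableEq V] [DecidableEq W] in
theorem mem_range_of_mk_mem_map {Q : Finset (Sym2 V)} {x y : W}
    (h : s(x, y) ∈ Q.map f.sym2Map) : x ∈ Set.range f ∧ y ∈ Set.range f := by
  obtain ⟨e, -, he⟩ := Finset.mem_map.1 h
  induction e with
  | _ a b =>
    rcases Sym2.eq_iff.1 he with ⟨rfl, rfl⟩ | ⟨rfl, rfl⟩ <;> simp

/-- Marked parts are the same in a marked graph and in a marked graph that induces it. -/
theorem isMarkedPart_map_iff {G : SimpleGraph V} {G' : SimpleGraph W} {M : Set (Sym2 V)}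
    {M' : Set (Sym2 W)} (hG : ∀ a b, G'.Adj (f a) (f b) ↔ G.Adj a b)
    (hM : ∀ e, f.sym2Map e ∈ M' ↔ e ∈ M) (Q : Finset (Sym2 V)) :
    IsMarkedPart G' M' (Q.map f.sym2Map) ↔ IsMarkedPart G M Q := by
  have hcard : ((Q.map f.sym2Map : Finset (Sym2 W)) ∩ M' : Set (Sym2 W)).ncard =
      ((Q : Set (Sym2 V)) ∩ M).ncard := by
    rw [← Set.ncard_image_of_injective _ f.sym2Map.injective]
    congr 1
    ext e
    simp only [Finset.coe_map, Set.mem_inter_iff, Set.mem_image]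
    grind
  have hM' : ∀ a b, s(f a, f b) ∈ M' ↔ s(a, b) ∈ M := fun a b => hM s(a, b)
  unfold IsMarkedPart
  rw [hcard]
  refine or_congr ⟨?_, ?_⟩ (or_congr (and_congr_left fun _ => ⟨?_, ?_⟩) ⟨?_, ?_⟩)
  · rintro ⟨c, a, b, d, hab, had, hbd, hca, hcb, hcd, hQ⟩
    have h₁ := mem_range_of_mk_mem_map (hQ ▸ by simp [clawEdges] : s(c, a) ∈ Q.map f.sym2Map)
    have h₂ := mem_range_of_mk_mem_map (hQ ▸ by simp [clawEdges] : s(c, b) ∈ Q.map f.sym2Map)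
    have h₃ := mem_range_of_mk_mem_map (hQ ▸ by simp [clawEdges] : s(c, d) ∈ Q.map f.sym2Map)
    obtain ⟨⟨c, rfl⟩, a, rfl⟩ := h₁
    obtain ⟨-, b, rfl⟩ := h₂
    obtain ⟨-, d, rfl⟩ := h₃
    rw [← map_clawEdges, Finset.map_inj] at hQ
    exact ⟨c, a, b, d, by grind, by grind, by grind, (hG _ _).1 hca, (hG _ _).1 hcb,
      (hG _ _).1 hcd, hQ⟩
  · rintro ⟨c, a, b, d, hab, had, hbd, hca, hcb, hcd, rfl⟩
    exact ⟨f c, f a, f b, f d, f.injective.ne hab, f.injective.ne had, f.injective.ne hbd,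
      (hG _ _).2 hca, (hG _ _).2 hcb, (hG _ _).2 hcd, map_clawEdges ..⟩
  · rintro ⟨u, v, w, ⟨huv, hvw, huw⟩, hQ⟩
    have h₁ := mem_range_of_mk_mem_map (hQ ▸ by simp [triEdges] : s(u, v) ∈ Q.map f.sym2Map)
    have h₂ := mem_range_of_mk_mem_map (hQ ▸ by simp [triEdges] : s(u, w) ∈ Q.map f.sym2Map)
    obtain ⟨⟨u, rfl⟩, v, rfl⟩ := h₁
    obtain ⟨-, w, rfl⟩ := h₂
    rw [← map_triEdges, Finset.map_inj] at hQ
    exact ⟨u, v, w, ⟨(hG _ _).1 huv, (hG _ _).1 hvw, (hG _ _).1 huw⟩, hQ⟩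
  · rintro ⟨u, v, w, ⟨huv, hvw, huw⟩, rfl⟩
    exact ⟨f u, f v, f w, ⟨(hG _ _).2 huv, (hG _ _).2 hvw, (hG _ _).2 huw⟩, map_triEdges ..⟩
  · rintro ⟨a, b, c, d, ⟨hab, hbc, hcd, hac, had, hbd⟩, hQ, hm⟩
    have h₁ := mem_range_of_mk_mem_map (hQ ▸ by simp [p4Edges] : s(a, b) ∈ Q.map f.sym2Map)
    have h₂ := mem_range_of_mk_mem_map (hQ ▸ by simp [p4Edges] : s(c, d) ∈ Q.map f.sym2Map)
    obtain ⟨⟨a, rfl⟩, b, rfl⟩ := h₁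
    obtain ⟨⟨c, rfl⟩, d, rfl⟩ := h₂
    rw [← map_p4Edges, Finset.map_inj] at hQ
    exact ⟨a, b, c, d, ⟨(hG _ _).1 hab, (hG _ _).1 hbc, (hG _ _).1 hcd, by grind, by grind,
      by grind⟩, hQ, fun h => hm ((hM' _ _).2 h)⟩
  · rintro ⟨a, b, c, d, ⟨hab, hbc, hcd, hac, had, hbd⟩, rfl, hm⟩
    exact ⟨f a, f b, f c, f d, ⟨(hG _ _).2 hab, (hG _ _).2 hbc, (hG _ _).2 hcd,
      f.injective.ne hac, f.injective.ne had, f.injective.ne hbd⟩, map_p4Edges ..,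
      fun h => hm ((hM' _ _).1 h)⟩

end Transfer

section Net

variable {G : SimpleGraph V} {M : Set (Sym2 V)} {t : Fin 3 → V}

/-- The marked edges after adding a net over `t 0`, `t 1`, `t 2`. -/
def netMarks (M : Set (Sym2 V)) (t : Fin 3 → V) : Set (Sym2 (V ⊕ Fin 3)) :=
  Sym2.map Sum.inl '' M ∪
    {s(Sum.inl (t 0), Sum.inr 0), s(Sum.inl (t 1), Sum.inr 1), s(Sum.inl (t 2), Sum.inr 2)}

/-- The triangle edges of a net. -/
def netTriangle (V : Type*) [DecidableEq V] : Finset (Sym2 (V ⊕ Fin 3)) :=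
  {s(Sum.inr 0, Sum.inr 1), s(Sum.inr 1, Sum.inr 2), s(Sum.inr 0, Sum.inr 2)}

/-- The edges of a net. -/
def netEdges [DecidableEq V] (t : Fin 3 → V) : Finset (Sym2 (V ⊕ Fin 3)) :=
  {s(Sum.inl (t 0), Sum.inr 0), s(Sum.inl (t 1), Sum.inr 1), s(Sum.inl (t 2), Sum.inr 2)} ∪
    netTriangle V

theorem sym2Map_inl_mem_netMarks (e : Sym2 V) :
    (Function.Embedding.inl : V ↪ V ⊕ Fin 3).sym2Map e ∈ netMarks M t ↔ e ∈ M := by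
  have := (Sym2.map.injective (Sum.inl_injective (α := V) (β := Fin 3))).mem_set_image
    (s := M) (a := e)
  induction e with
  | _ a b => simpa [netMarks] using this

@[simp] theorem mk_inr_inr_notMem_netMarks (i j : Fin 3) :
    s(Sum.inr i, Sum.inr j) ∉ netMarks M t := by
  simp [netMarks, Sym2.forall]

@[simp] theorem mk_inl_inr_mem_netMarks (a : V) (i : Fin 3) :
    s(Sum.inl a, Sum.inr i) ∈ netMarks M t ↔ a = t i := by
  fin_cases i <;> simp [netMarks, Sym2.forall]

@[simp] theorem mk_inr_inl_mem_netMarks (a : V) (i : Fin 3) :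
    s(Sum.inr i, Sum.inl a) ∈ netMarks M t ↔ a = t i := by
  rw [Sym2.eq_swap, mk_inl_inr_mem_netMarks]

@[simp] theorem netAdd_adj_inl_inl (a b : V) :
    (netAdd G (t 0) (t 1) (t 2)).Adj (Sum.inl a) (Sum.inl b) ↔ G.Adj a b := by
  have := (Sym2.map.injective (Sum.inl_injective (α := V) (β := Fin 3))).mem_set_image
    (s := G.edgeSet) (a := s(a, b))
  have h := fun h : G.Adj a b => h.ne
  simp at this
  simp [netAdd, this]
  exact h

@[simp] theorem netAdd_adj_inl_inr (a : V) (i : Fin 3) :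
    (netAdd G (t 0) (t 1) (t 2)).Adj (Sum.inl a) (Sum.inr i) ↔ a = t i := by
  fin_cases i <;> simp [netAdd, Sym2.exists]

@[simp] theorem netAdd_adj_inr_inl (a : V) (i : Fin 3) :
    (netAdd G (t 0) (t 1) (t 2)).Adj (Sum.inr i) (Sum.inl a) ↔ a = t i := by
  rw [adj_comm, netAdd_adj_inl_inr]

@[simp] theorem netAdd_adj_inr_inr (i j : Fin 3) :
    (netAdd G (t 0) (t 1) (t 2)).Adj (Sum.inr i) (Sum.inr j) ↔ i ≠ j := by
  fin_cases i <;> fin_cases j <;> simp [netAdd, Sym2.exists]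

theorem ncard_neighborSet_netAdd_inl_of_notMem {v : V} (hv : v ∉ Set.range t) :
    ((netAdd G (t 0) (t 1) (t 2)).neighborSet (Sum.inl v)).ncard =
      (G.neighborSet v).ncard := by
  rw [← Set.ncard_image_of_injective (G.neighborSet v) (Sum.inl_injective (β := Fin 3))]
  refine congrArg Set.ncard (Set.ext ?_)
  rintro (a | i)
  · simp
  · have : v ≠ t i := fun h => hv ⟨i, h.symm⟩
    simp [this]

theorem ncard_neighborSet_netAdd_inl_apply [Finite V] (ht : t.Injective) (i : Fin 3) :
    ((netAdd G (t 0) (t 1) (t 2)).neighborSet (Sum.inl (t i))).ncard =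
      (G.neighborSet (t i)).ncard + 1 := by
  rw [← Set.ncard_image_of_injective (G.neighborSet (t i)) (Sum.inl_injective (β := Fin 3)),
    ← Set.ncard_insert_of_notMem (a := Sum.inr i) (by simp) (Set.toFinite _)]
  refine congrArg Set.ncard (Set.ext ?_)
  rintro (a | j)
  · simp
  · simp [ht.eq_iff, eq_comm]

theorem ncard_neighborSet_netAdd_inr (i : Fin 3) :
    ((netAdd G (t 0) (t 1) (t 2)).neighborSet (Sum.inr i)).ncard = 3 := by
  have : (netAdd G (t 0) (t 1) (t 2)).neighborSet (Sum.inr i) =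
      {Sum.inl (t i), Sum.inr (i + 1), Sum.inr (i + 2)} := by
    ext (a | j)
    · simp
    · simp only [mem_neighborSet, netAdd_adj_inr_inr, Set.mem_insert_iff, reduceCtorEq,
        Set.mem_singleton_iff, Sum.inr.injEq, false_or]
      decide +revert
  rw [this, Set.ncard_eq_three]
  refine ⟨_, _, _, by simp, by simp, ?_, rfl⟩
  simp

theorem ncard_degree_two_netAdd [Finite V] (ht : t.Injective)
    (h2 : ∀ i, (G.neighborSet (t i)).ncard = 2) :
    {v | (G.neighborSet v).ncard = 2}.ncard =
      {p | ((netAdd G (t 0) (t 1) (t 2)).neighborSet p).ncard = 2}.ncard + 3 := by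
  have hset : {p | ((netAdd G (t 0) (t 1) (t 2)).neighborSet p).ncard = 2} =
      Sum.inl '' ({v | (G.neighborSet v).ncard = 2} \ Set.range t) := by
    ext (v | i)
    · by_cases hv : v ∈ Set.range t
      · obtain ⟨i, rfl⟩ := hv
        simp [ncard_neighborSet_netAdd_inl_apply ht, h2]
      · simpa [ncard_neighborSet_netAdd_inl_of_notMem hv] using fun _ => not_exists.1 hv
    · simp [ncard_neighborSet_netAdd_inr]
  have hrange : (Set.range t).ncard = 3 := by
    rw [← Set.image_univ, Set.ncard_image_of_injective _ ht]
    simp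
  rw [hset, Set.ncard_image_of_injective _ Sum.inl_injective,
    ← Set.ncard_sdiff_add_ncard_of_subset (s := Set.range t) (by rintro _ ⟨i, rfl⟩; exact h2 i),
    hrange]

variable [DecidableEq V]

@[simp] theorem mk_inl_inl_notMem_netEdges (a b : V) :
    s(Sum.inl a, Sum.inl b) ∉ netEdges t := by
  simp [netEdges, netTriangle]

@[simp] theorem mk_inl_inr_mem_netEdges (a : V) (i : Fin 3) :
    s(Sum.inl a, Sum.inr i) ∈ netEdges t ↔ a = t i := by
  fin_cases i <;> simp [netEdges, netTriangle]

@[simp] theorem mk_inr_inl_mem_netEdges (a : V) (i : Fin 3) :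
    s(Sum.inr i, Sum.inl a) ∈ netEdges t ↔ a = t i := by
  rw [Sym2.eq_swap, mk_inl_inr_mem_netEdges]

@[simp] theorem mk_inr_inr_mem_netEdges (i j : Fin 3) :
    s(Sum.inr i, Sum.inr j) ∈ netEdges t ↔ i ≠ j := by
  fin_cases i <;> fin_cases j <;> simp [netEdges, netTriangle]

theorem sym2Map_inl_notMem_netEdges (e : Sym2 V) : Sym2.map Sum.inl e ∉ netEdges t := by
  induction e with
  | _ a b => simp

theorem mem_edgeSet_netAdd (e : Sym2 (V ⊕ Fin 3)) :
    e ∈ (netAdd G (t 0) (t 1) (t 2)).edgeSet ↔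
      (∃ e' ∈ G.edgeSet, Sym2.map Sum.inl e' = e) ∨ e ∈ netEdges t := by
  induction e with
  | _ x y =>
    rcases x with a | i <;> rcases y with b | j
    · have := (Sym2.map.injective (Sum.inl_injective (α := V) (β := Fin 3))).mem_set_image
        (s := G.edgeSet) (a := s(a, b))
      simpa using this.symm
    all_goals simp [Sym2.exists]

omit [DecidableEq V] in
theorem sym2Map_inl_mem_edgeSet_netAdd (e : Sym2 V) :
    Sym2.map Sum.inl e ∈ (netAdd G (t 0) (t 1) (t 2)).edgeSet ↔ e ∈ G.edgeSet := by
  induction e with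
  | _ a b => simp

/-- A marked part using a triangle edge of the net lies inside the net and is not the triangle. -/
theorem IsMarkedPart.of_mk_inr_inr_mem (ht : t.Injective) {P : Finset (Sym2 (V ⊕ Fin 3))}
    (hP : IsMarkedPart (netAdd G (t 0) (t 1) (t 2)) (netMarks M t) P) {i j : Fin 3}
    (hij : s(Sum.inr i, Sum.inr j) ∈ P) :
    P ⊆ netEdges t ∧ ∃ k, s(Sum.inl (t k), Sum.inr k) ∈ P := by
  rcases hP with ⟨c, a, b, d, hab, had, hbd, hca, hcb, hcd, rfl⟩ |
    ⟨⟨u, v, w, ⟨huv, hvw, huw⟩, rfl⟩, hm⟩ | ⟨a, b, c, d, ⟨hab, hbc, hcd, hac, had, hbd⟩, rfl, hm⟩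
  · rcases c with c | c
    · simp [clawEdges] at hij
    · rcases a with a | a <;> rcases b with b | b <;> rcases d with d | d <;>
        simp [clawEdges, Finset.insert_subset_iff] at * <;> grind
  · rcases u with u | u <;> rcases v with v | v <;> rcases w with w | w <;>
      simp [triEdges, Finset.insert_subset_iff, Set.insert_inter_of_notMem] at * <;> grind
  · rcases a with a | a <;> rcases b with b | b <;> rcases c with c | c <;>
      rcases d with d | d <;>
      simp [p4Edges, Finset.insert_subset_iff] at * <;> grind

theorem card_netEdges_le : (netEdges t).card ≤ 6 :=
  (Finset.card_union_le _ _).trans (Nat.add_le_add Finset.card_le_three Finset.card_le_three)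

theorem card_netTriangle : (netTriangle V).card = 3 := by
  refine Finset.card_eq_three.2 ⟨_, _, _, ?_, ?_, ?_, rfl⟩ <;> simp

/-- In a decomposition, every part meeting the net lies inside the net. -/
theorem IsMarkedDecompOn.subset_netEdges (ht : t.Injective)
    {D : Finset (Finset (Sym2 (V ⊕ Fin 3)))}
    (hD : IsMarkedDecompOn (netAdd G (t 0) (t 1) (t 2)) (netMarks M t) D)
    {P : Finset (Sym2 (V ⊕ Fin 3))} (hP : P ∈ D) {e : Sym2 (V ⊕ Fin 3)} (heP : e ∈ P)
    (he : e ∈ netEdges t) : P ⊆ netEdges t := by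
  obtain ⟨hpart, hdisj, hcov⟩ := hD
  set U := (D.filter (· ⊆ netEdges t)).biUnion id with hU
  have hUcard : U.card = 3 * (D.filter (· ⊆ netEdges t)).card := by
    rw [hU, Finset.card_biUnion, Finset.sum_const_nat (m := 3), mul_comm]
    · exact fun Q hQ => IsMarkedPart.card_eq_three (hpart Q (Finset.mem_filter.1 hQ).1)
    · exact fun Q hQ R hR hQR => hdisj (Finset.mem_filter.1 hQ).1 (Finset.mem_filter.1 hR).1 hQR
  have hUN : U ⊆ netEdges t :=
    Finset.biUnion_subset.2 fun Q hQ => (Finset.mem_filter.1 hQ).2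
  have htri : ∀ i j : Fin 3, i ≠ j → ∃ Q ∈ D, s(Sum.inr i, Sum.inr j) ∈ Q := fun i j hij =>
    (hcov _).1 (by simpa using hij)
  have hmem : ∀ Q ∈ D, Q ⊆ netEdges t → Q ⊆ U := fun Q hQ hQN =>
    Finset.subset_biUnion_of_mem id (Finset.mem_filter.2 ⟨hQ, hQN⟩)
  have hinr : ∀ i j : Fin 3, i ≠ j → s(Sum.inr i, Sum.inr j) ∈ U := by
    intro i j hij
    obtain ⟨Q, hQ, hQe⟩ := htri i j hij
    exact hmem Q hQ (IsMarkedPart.of_mk_inr_inr_mem ht (hpart Q hQ) hQe).1 hQe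
  obtain ⟨Q, hQ, hQe⟩ := htri 0 1 (by decide)
  obtain ⟨hQN, k, hk⟩ := IsMarkedPart.of_mk_inr_inr_mem ht (hpart Q hQ) hQe
  have hlt : netTriangle V ⊂ U := by
    refine Finset.ssubset_iff.2 ⟨s(Sum.inl (t k), Sum.inr k), by simp [netTriangle], ?_⟩
    simp [netTriangle, Finset.insert_subset_iff, hinr, hmem Q hQ hQN hk]
  have h3 := Finset.card_lt_card hlt
  rw [card_netTriangle] at h3
  have hUeq : U = netEdges t := Finset.eq_of_subset_of_card_le hUN (by
    have := card_netEdges_le (t := t)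
    omega)
  obtain ⟨R, hR, heR⟩ := Finset.mem_biUnion.1 (hUeq ▸ he)
  obtain ⟨hRD, hRN⟩ := Finset.mem_filter.1 hR
  have : P = R := by
    by_contra h
    exact Finset.disjoint_left.1 (hdisj hP hRD h) heP heR
  exact this ▸ hRN

theorem exists_isMarkedDecompOn_of_netAdd [Fintype V] (ht : t.Injective)
    {D : Finset (Finset (Sym2 (V ⊕ Fin 3)))}
    (hD : IsMarkedDecompOn (netAdd G (t 0) (t 1) (t 2)) (netMarks M t) D) :
    ∃ D : Finset (Finset (Sym2 V)), IsMarkedDecompOn G M D := by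
  have hsub := fun P => hD.subset_netEdges (P := P) ht
  obtain ⟨hpart, hdisj, hcov⟩ := hD
  let f : V ↪ V ⊕ Fin 3 := .inl
  refine ⟨Finset.univ.filter fun Q => Q.map f.sym2Map ∈ D, ?_, ?_, fun e => ⟨fun he => ?_, ?_⟩⟩
  · intro Q hQ
    exact (isMarkedPart_map_iff (f := f) netAdd_adj_inl_inl sym2Map_inl_mem_netMarks Q).1
      (hpart _ (Finset.mem_filter.1 hQ).2)
  · intro Q hQ R hR hQR
    simp only [Finset.coe_filter, Finset.mem_univ, true_and, Set.mem_ofPred_eq] at hQ hR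
    exact (Finset.disjoint_map f.sym2Map).1 (hdisj hQ hR ((Finset.map_injective _).ne hQR))
  · obtain ⟨P, hP, heP⟩ := (hcov _).1 (sym2Map_inl_mem_edgeSet_netAdd e |>.2 he)
    have hPmap : ∃ Q : Finset (Sym2 V), Q.map f.sym2Map = P := by
      have hr : (P : Set (Sym2 (V ⊕ Fin 3))) ⊆ f.sym2Map '' Set.univ := by
        intro x hx
        rcases (mem_edgeSet_netAdd x).1 ((hcov x).2 ⟨P, hP, hx⟩) with ⟨y, -, rfl⟩ | hxN
        · exact ⟨y, trivial, rfl⟩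
        · exact absurd (hsub P hP hx hxN heP) (sym2Map_inl_notMem_netEdges e)
      obtain ⟨Q, -, hQ⟩ := Finset.subset_set_image_iff.1 hr
      exact ⟨Q, by rw [Finset.map_eq_image, hQ]⟩
    obtain ⟨Q, rfl⟩ := hPmap
    exact ⟨Q, by simpa using hP, (Finset.mem_map' f.sym2Map).1 heP⟩
  · rintro ⟨Q, hQ, heQ⟩
    exact (sym2Map_inl_mem_edgeSet_netAdd e).1
      ((hcov _).2 ⟨_, (Finset.mem_filter.1 hQ).2, Finset.mem_map_of_mem f.sym2Map heQ⟩)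

theorem p4Edges_union_clawEdges_net :
    p4Edges (Sum.inl (t 0)) (Sum.inr 0) (Sum.inr 1) (Sum.inl (t 1)) ∪
      clawEdges (Sum.inr 2) (Sum.inl (t 2)) (Sum.inr 0) (Sum.inr 1) = netEdges t := by
  ext e
  simp only [p4Edges, clawEdges, netEdges, netTriangle, Finset.mem_union, Finset.mem_insert,
    Finset.mem_singleton]
  grind [Sym2.eq_swap]

theorem exists_isMarkedDecompOn_netAdd (ht : t.Injective) {D : Finset (Finset (Sym2 V))}
    (hD : IsMarkedDecompOn G M D) :
    ∃ D' : Finset (Finset (Sym2 (V ⊕ Fin 3))),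
      IsMarkedDecompOn (netAdd G (t 0) (t 1) (t 2)) (netMarks M t) D' := by
  obtain ⟨hpart, hdisj, hcov⟩ := hD
  let f : V ↪ V ⊕ Fin 3 := .inl
  set A : Finset (Sym2 (V ⊕ Fin 3)) := p4Edges (Sum.inl (t 0)) (Sum.inr 0) (Sum.inr 1) (Sum.inl (t 1)) with hA
  set B : Finset (Sym2 (V ⊕ Fin 3)) := clawEdges (Sum.inr 2) (Sum.inl (t 2)) (Sum.inr 0) (Sum.inr 1) with hB
  have hAB : A ∪ B = netEdges t := p4Edges_union_clawEdges_net
  have hdAB : Disjoint A B := by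
    simp [hA, hB, p4Edges, clawEdges]
  have hdN : ∀ Q : Finset (Sym2 V), Disjoint (Q.map f.sym2Map) (netEdges t) := by
    refine fun Q => Finset.disjoint_left.2 fun x hx => ?_
    obtain ⟨y, -, rfl⟩ := Finset.mem_map.1 hx
    exact sym2Map_inl_notMem_netEdges y
  have hdA := fun Q => (hdN Q).mono_right (hAB ▸ Finset.subset_union_left : A ⊆ netEdges t)
  have hdB := fun Q => (hdN Q).mono_right (hAB ▸ Finset.subset_union_right : B ⊆ netEdges t)
  refine ⟨insert A (insert B (D.map (Finset.mapEmbedding f.sym2Map).toEmbedding)), ?_, ?_, ?_⟩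
  · intro P hP
    simp only [Finset.mem_insert, Finset.mem_map] at hP
    rcases hP with rfl | rfl | ⟨Q, hQ, rfl⟩
    · exact .inr (.inr ⟨_, _, _, _, ⟨by simp, by simp, by simp, by simp, by simp [ht.eq_iff],
        by simp⟩, rfl, mk_inr_inr_notMem_netMarks 0 1⟩)
    · exact .inl ⟨_, _, _, _, by simp, by simp, by simp, by simp, by simp, by simp, rfl⟩
    · exact (isMarkedPart_map_iff (f := f) netAdd_adj_inl_inl sym2Map_inl_mem_netMarks Q).2
        (hpart Q hQ)
  · rw [Finset.coe_insert, Finset.coe_insert, Set.pairwiseDisjoint_insert,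
      Set.pairwiseDisjoint_insert]
    refine ⟨⟨?_, ?_⟩, ?_⟩
    · intro P hP R hR hPR
      obtain ⟨P, hPD, rfl⟩ := Finset.mem_map.1 hP
      obtain ⟨R, hRD, rfl⟩ := Finset.mem_map.1 hR
      exact (Finset.disjoint_map f.sym2Map).2 (hdisj hPD hRD (by rintro rfl; exact hPR rfl))
    · intro P hP _
      obtain ⟨P, hP, rfl⟩ := Finset.mem_map.1 hP
      exact (hdB P).symm
    · rintro P (rfl | hP) _
      · exact hdAB
      · obtain ⟨P, hP, rfl⟩ := Finset.mem_map.1 hP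
        exact (hdA P).symm
  · intro e
    rw [mem_edgeSet_netAdd, ← hAB, Finset.mem_union]
    simp only [Finset.mem_insert, Finset.mem_map, exists_eq_or_imp, hcov]
    constructor
    · rintro (⟨e, ⟨P, hP, heP⟩, rfl⟩ | h | h)
      · exact .inr (.inr ⟨_, ⟨P, hP, rfl⟩, Finset.mem_map_of_mem f.sym2Map heP⟩)
      · exact .inl h
      · exact .inr (.inl h)
    · rintro (h | h | ⟨_, ⟨P, hP, rfl⟩, he⟩)
      · exact .inr (.inl h)
      · exact .inr (.inr h)
      · obtain ⟨e, heP, rfl⟩ := Finset.mem_map.1 he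
        exact .inl ⟨e, ⟨P, hP, heP⟩, rfl⟩

end Net

/-- Adding a net over three degree-2 vertices, and marking the three connecting
edges, yields a degree-2,3 graph with three fewer degree-2 vertices, whose
marked decomposability is equivalent to that of the original marked graph. -/
theorem stmt_14 [Fintype V] [DecidableEq V] (G : SimpleGraph V)
    (hdeg : ∀ v : V, (G.neighborSet v).ncard = 2 ∨ (G.neighborSet v).ncard = 3)
    (M : Set (Sym2 V)) (hM : M ⊆ G.edgeSet)
    (t₁ t₂ t₃ : V) (h12 : t₁ ≠ t₂) (h13 : t₁ ≠ t₃) (h23 : t₂ ≠ t₃)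
    (ht₁ : (G.neighborSet t₁).ncard = 2) (ht₂ : (G.neighborSet t₂).ncard = 2)
    (ht₃ : (G.neighborSet t₃).ncard = 2) :
    (∀ p : V ⊕ Fin 3, ((netAdd G t₁ t₂ t₃).neighborSet p).ncard = 2 ∨
        ((netAdd G t₁ t₂ t₃).neighborSet p).ncard = 3) ∧
    ({v : V | (G.neighborSet v).ncard = 2}.ncard =
      {p : V ⊕ Fin 3 | ((netAdd G t₁ t₂ t₃).neighborSet p).ncard = 2}.ncard + 3) ∧
    ((∃ D : Finset (Finset (Sym2 V)), IsMarkedDecompOn G M D) ↔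
      ∃ D' : Finset (Finset (Sym2 (V ⊕ Fin 3))),
        IsMarkedDecompOn (netAdd G t₁ t₂ t₃)
          (Sym2.map Sum.inl '' M ∪
            {s(Sum.inl t₁, Sum.inr 0), s(Sum.inl t₂, Sum.inr 1), s(Sum.inl t₃, Sum.inr 2)})
          D') := by
  obtain ⟨t, rfl, rfl, rfl⟩ : ∃ t : Fin 3 → V, t 0 = t₁ ∧ t 1 = t₂ ∧ t 2 = t₃ :=
    ⟨![t₁, t₂, t₃], rfl, rfl, rfl⟩
  have ht : t.Injective := by
    intro i j
    fin_cases i <;> fin_cases j <;> simp [h12, h13, h23, h12.symm, h13.symm, h23.symm]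
  have h2 : ∀ i, (G.neighborSet (t i)).ncard = 2 := by
    intro i
    fin_cases i
    exacts [ht₁, ht₂, ht₃]
  refine ⟨?_, ncard_degree_two_netAdd ht h2,
    fun ⟨_, hD⟩ => exists_isMarkedDecompOn_netAdd ht hD,
    fun ⟨_, hD⟩ => exists_isMarkedDecompOn_of_netAdd ht hD⟩
  rintro (v | i)
  · by_cases hv : v ∈ Set.range t
    · obtain ⟨i, rfl⟩ := hv
      exact .inr ((ncard_neighborSet_netAdd_inl_apply ht i).trans (by rw [h2 i]))
    · rw [ncard_neighborSet_netAdd_inl_of_notMem hv]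
      exact hdeg v
  · exact .inr (ncard_neighborSet_netAdd_inr i)
end
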